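/- arXiv:cs/0607054 — 10 statements merged into one kernel-verified Lean document; each statement's English description precedes it below -/
import Mathlib

section
/- Ville's Theorem: For every countable collection E of selection functions there exists a real q such that: (1) lim_{n→∞} S_q(n)/n = 1/2; (2) for every f ∈ E that selects an infinite subsequence of q, lim_{m→∞} S_{f,q}(m)/m = 1/2; and (3) for every n ≥ 1, 2·S_q(n) ≤ n (the number of 1's in every initial segment never exceeds the number of 0's). -/
open Filter

/-- The initial segment `q[n] = (q(1), …, q(n-1))` of a real (infinite binary
sequence) `q`, viewed as a finite binary sequence (list of booleans). -/
def initSeg (q : ℕ → Bool) (n : ℕ) : List Bool :=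
  (List.range (n - 1)).map (fun i => q (i + 1))

/-- The value of a bit, as a natural number. -/
def bitVal (b : Bool) : ℕ := if b then 1 else 0

/-- `S q n = Σ_{i=1}^{n} q(i)`, the number of 1's among the first `n` bits. -/
def S (q : ℕ → Bool) (n : ℕ) : ℕ := ∑ i ∈ Finset.Icc 1 n, bitVal (q i)

/-- `Sf q e m = Σ_{k=1}^{m} q(n_k)`, where `e k = n_{k+1}` enumerates the
selected positions in increasing order. -/
def Sf (q : ℕ → Bool) (e : ℕ → ℕ) (m : ℕ) : ℕ :=
  ∑ k ∈ Finset.range m, bitVal (q (e k))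

namespace Ville

/-- The first `d` answers of the selection functions on history `h`. -/
def pat (F : ℕ → List Bool → Bool) (h : List Bool) (d : ℕ) : List Bool :=
  (List.range d).map (fun j => F j h)

noncomputable def depth (F : ℕ → List Bool → Bool) (p : List Bool × List (List Bool)) : ℕ :=
  sInf {d | p.2.count (pat F p.1 d) < d + 1}

noncomputable def node (F : ℕ → List Bool → Bool) (p : List Bool × List (List Bool)) : List Bool :=
  pat F p.1 (depth F p)

noncomputable def bit (F : ℕ → List Bool → Bool) (p : List Bool × List (List Bool)) : Bool :=
  decide (p.2.count (node F p) % 2 = 1)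

noncomputable def st (F : ℕ → List Bool → Bool) : ℕ → List Bool × List (List Bool)
  | 0 => ([], [])
  | n + 1 => ((st F n).1 ++ [bit F (st F n)], node F (st F n) :: (st F n).2)

noncomputable def qq (F : ℕ → List Bool → Bool) (n : ℕ) : Bool := bit F (st F (n - 1))

lemma initSeg_qq (F : ℕ → List Bool → Bool) (n : ℕ) : initSeg (qq F) (n + 1) = (st F n).1 := by
  induction n with
  | zero => simp [initSeg, st]
  | succ n ih =>
    simp only [initSeg, Nat.add_sub_cancel] at ih ⊢
    rw [List.range_succ, List.map_append, ih]
    simp [st, qq]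

lemma depth_nonempty (F : ℕ → List Bool → Bool) (p : List Bool × List (List Bool)) :
    {d | p.2.count (pat F p.1 d) < d + 1}.Nonempty := by
  refine ⟨p.2.toFinset.sup List.length + 1, ?_⟩
  have : pat F p.1 (p.2.toFinset.sup List.length + 1) ∉ p.2 := by
    intro h
    have := Finset.le_sup (f := List.length) (List.mem_toFinset.2 h)
    rw [show (pat F p.1 (p.2.toFinset.sup List.length + 1)).length
      = p.2.toFinset.sup List.length + 1 by simp [pat]] at this
    omega
  simp [List.count_eq_zero_of_not_mem this]

lemma depth_lt (F : ℕ → List Bool → Bool) (p : List Bool × List (List Bool)) :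
    p.2.count (node F p) < depth F p + 1 := Nat.sInf_mem (depth_nonempty F p)

lemma depth_min (F : ℕ → List Bool → Bool) (p : List Bool × List (List Bool)) (d : ℕ)
    (hd : d < depth F p) : d + 1 ≤ p.2.count (pat F p.1 d) := by
  have := Nat.notMem_of_lt_sInf hd
  simpa using this

lemma length_node (F : ℕ → List Bool → Bool) (p : List Bool × List (List Bool)) :
    (node F p).length = depth F p := by simp [node, pat]

noncomputable def N (F : ℕ → List Bool → Bool) (n : ℕ) : List Bool := node F (st F n)

noncomputable def sg (F : ℕ → List Bool → Bool) (n : ℕ) : ℤ :=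
  if bit F (st F n) then 1 else -1

lemma count_eq (F : ℕ → List Bool → Bool) (n : ℕ) (w : List Bool) :
    (st F n).2.count w = ((Finset.range n).filter (fun i => N F i = w)).card := by
  induction n with
  | zero => simp [st]
  | succ n ih =>
    rw [Finset.range_add_one, Finset.filter_insert, st, List.count_cons, ih]
    by_cases h : N F n = w
    · have h' : node F (st F n) = w := h
      simp [h, h']
    · have h' : ¬ node F (st F n) = w := h
      simp [h, h']

lemma count_le (F : ℕ → List Bool → Bool) (n : ℕ) (w : List Bool) :
    (st F n).2.count w ≤ w.length + 1 := by
  induction n with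
  | zero => simp [st]
  | succ n ih =>
    rw [st, List.count_cons]
    by_cases h : node F (st F n) = w
    · have := depth_lt F (st F n)
      rw [← length_node, h] at this
      simp [h]; omega
    · simp [h]; omega

lemma sum_sg (F : ℕ → List Bool → Bool) (n : ℕ) (w : List Bool) :
    ∑ i ∈ (Finset.range n).filter (fun i => N F i = w), sg F i
      = -(((st F n).2.count w % 2 : ℕ) : ℤ) := by
  induction n with
  | zero => simp [st]
  | succ n ih =>
    rw [Finset.range_add_one, Finset.filter_insert, st, List.count_cons]
    by_cases h : N F n = w
    · have h' : node F (st F n) = w := h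
      simp only [h, if_true]
      rw [Finset.sum_insert (by simp), ih]
      simp only [sg, bit, h', beq_self_eq_true, if_true, decide_eq_true_eq]
      split_ifs <;> omega
    · have h' : ¬ node F (st F n) = w := h
      simp [h, h', ih]

lemma node_getElem (F : ℕ → List Bool → Bool) (i j : ℕ) (h : j < (N F i).length) :
    (N F i)[j]? = some (F j (st F i).1) := by
  have : j < depth F (st F i) := by rw [← length_node]; exact h
  simp [N, node, pat, this]

lemma total_nonpos (F : ℕ → List Bool → Bool) (n : ℕ) :
    ∑ i ∈ Finset.range n, sg F i ≤ 0 := by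
  rw [← Finset.sum_fiberwise_of_maps_to (t := (Finset.range n).image (N F)) (g := N F)
    (fun i hi => Finset.mem_image_of_mem _ hi)]
  apply Finset.sum_nonpos
  intro w _
  rw [sum_sg]; omega

lemma abs_sg (F : ℕ → List Bool → Bool) (n : ℕ) : |sg F n| = 1 := by
  unfold sg; split_ifs <;> simp

/-- times when the `j`-th function selects -/
noncomputable def T (F : ℕ → List Bool → Bool) (j n : ℕ) : Finset ℕ :=
  (Finset.range n).filter (fun i => F j (st F i).1 = true)

lemma low_bound (F : ℕ → List Bool → Bool) (D : ℕ) : ∃ K : ℕ, ∀ n,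
    ((Finset.range n).filter (fun i => (N F i).length ≤ D)).card ≤ K := by
  have hf : {l : List Bool | l.length ≤ D}.Finite := List.finite_length_le Bool D
  refine ⟨hf.toFinset.card * (D + 1), fun n => ?_⟩
  rw [mul_comm]
  refine Finset.card_le_mul_card_image_of_maps_to (f := N F) (t := hf.toFinset) ?_ _ ?_
  · intro i hi
    simp at hi ⊢
    exact hi.2
  · intro w hw
    simp at hw
    have := count_le F n w
    rw [count_eq] at this
    refine le_trans (Finset.card_le_card ?_) (this.trans (by omega))
    intro i
    simp
    tauto

lemma high_bound (F : ℕ → List Bool → Bool) (j D n : ℕ) (hD : j < D) :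
    (((Finset.range n).image (N F)).filter
      (fun w => D < w.length ∧ w[j]? = some true)).card * (D + 1) ≤ (T F j n).card * 2 := by
  classical
  refine Finset.card_mul_le_card_mul (fun w i => N F i = w.dropLast) ?_ ?_
  · intro w hw
    simp only [Finset.mem_filter, Finset.mem_image, Finset.mem_range] at hw
    obtain ⟨⟨i, hi, rfl⟩, hl, hj⟩ := hw
    have hdrop : (N F i).dropLast = pat F (st F i).1 (depth F (st F i) - 1) := by
      simp [N, node, pat, List.dropLast_eq_take, ← List.map_take, List.take_range]
    have hlen : (N F i).length = depth F (st F i) := length_node _ _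
    have h1 := depth_min F (st F i) (depth F (st F i) - 1) (by omega)
    rw [← hdrop, count_eq] at h1
    have h2 : D + 1 ≤ ((Finset.range i).filter (fun i' => N F i' = (N F i).dropLast)).card := by
      omega
    refine h2.trans (Finset.card_le_card ?_)
    intro k hk
    simp only [Finset.mem_filter, Finset.mem_range] at hk
    have hkl : (N F k).length = (N F i).length - 1 := by rw [hk.2]; simp
    have h3 := node_getElem F k j (by omega)
    rw [hk.2, List.dropLast_eq_take, List.getElem?_take, if_pos (by omega), hj] at h3
    simp only [Finset.bipartiteAbove, T, Finset.mem_filter, Finset.mem_range]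
    refine ⟨⟨by omega, ?_⟩, hk.2⟩
    exact (Option.some.inj h3).symm
  · intro i hi
    refine le_trans (Finset.card_le_card (t := {N F i ++ [true], N F i ++ [false]}) ?_)
      Finset.card_le_two
    intro w hw
    simp only [Finset.bipartiteBelow, Finset.mem_filter] at hw
    obtain ⟨⟨_, hl, _⟩, h⟩ := hw
    have hne : w ≠ [] := by rintro rfl; simp at hl
    have := List.dropLast_append_getLast hne
    rw [← h] at this
    simp only [Finset.mem_insert, Finset.mem_singleton]
    cases hb : w.getLast hne
    · right; rw [hb] at this; exact this.symm
    · left; rw [hb] at this; exact this.symm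

lemma main_bound (F : ℕ → List Bool → Bool) (j D : ℕ) (hD : j < D) : ∃ K : ℕ, ∀ n,
    |∑ i ∈ T F j n, sg F i| * (D + 1) ≤ K + 2 * (T F j n).card := by
  obtain ⟨K, hK⟩ := low_bound F D
  refine ⟨K * (D + 1), fun n => ?_⟩
  set W := ((Finset.range n).image (N F)).filter
      (fun w => D < w.length ∧ w[j]? = some true) with hW
  have hhigh := high_bound F j D n hD
  rw [← hW] at hhigh
  rw [← Finset.sum_filter_add_sum_filter_not (T F j n) (fun i => (N F i).length ≤ D)]
  have h1 : |∑ i ∈ (T F j n).filter (fun i => (N F i).length ≤ D), sg F i| ≤ K := by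
    refine (Finset.abs_sum_le_sum_abs _ _).trans ?_
    simp only [abs_sg, Finset.sum_const, nsmul_eq_mul, mul_one]
    have := (Finset.card_le_card (Finset.filter_subset_filter
      (fun i => (N F i).length ≤ D) (Finset.filter_subset _ _ : T F j n ⊆ _))).trans (hK n)
    exact_mod_cast this
  have h2 : |∑ i ∈ (T F j n).filter (fun i => ¬ (N F i).length ≤ D), sg F i| ≤ W.card := by
    rw [← Finset.sum_fiberwise_of_maps_to (t := W) (g := N F)]
    · refine (Finset.abs_sum_le_sum_abs _ _).trans ?_
      rw [Finset.card_eq_sum_ones]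
      push_cast
      apply Finset.sum_le_sum
      intro w hw
      have : ((T F j n).filter (fun i => ¬ (N F i).length ≤ D)).filter (fun i => N F i = w)
          = (Finset.range n).filter (fun i => N F i = w) := by
        ext i
        simp only [hW, Finset.mem_filter] at hw
        simp only [T, Finset.mem_filter]
        constructor
        · tauto
        · rintro ⟨hi, rfl⟩
          have h3 := node_getElem F i j (by omega)
          rw [hw.2.2] at h3
          exact ⟨⟨⟨hi, (Option.some.inj h3).symm⟩, by omega⟩, rfl⟩
      rw [this, sum_sg, abs_neg]
      rw [abs_of_nonneg (by omega)]
      omega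
    · intro i hi
      simp only [T, Finset.mem_filter] at hi
      simp only [hW, Finset.mem_filter]
      refine ⟨Finset.mem_image_of_mem _ hi.1.1, by omega, ?_⟩
      rw [node_getElem F i j (by omega), hi.1.2]
  have h3 := (abs_add_le (∑ i ∈ (T F j n).filter (fun i => (N F i).length ≤ D), sg F i)
    (∑ i ∈ (T F j n).filter (fun i => ¬ (N F i).length ≤ D), sg F i)).trans (add_le_add h1 h2)
  have h4 : (W.card : ℤ) * (D + 1) ≤ (T F j n).card * 2 := by exact_mod_cast hhigh
  have h5 := mul_le_mul_of_nonneg_right h3 (show (0 : ℤ) ≤ D + 1 by omega)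
  push_cast
  linarith

lemma bitVal_eq (F : ℕ → List Bool → Bool) (n : ℕ) :
    2 * (bitVal (qq F (n + 1)) : ℤ) = 1 + sg F n := by
  simp only [bitVal, qq, sg, Nat.add_sub_cancel]
  split_ifs <;> simp

lemma sel_tendsto (F : ℕ → List Bool → Bool) (j : ℕ) (e : ℕ → ℕ) (he : StrictMono e)
    (hr : Set.range e = {n | 1 ≤ n ∧ F j (initSeg (qq F) n) = true}) :
    Tendsto (fun m => (Sf (qq F) e m : ℝ) / m) atTop (nhds (1 / 2)) := by
  have hpos : ∀ k, 1 ≤ e k ∧ F j (initSeg (qq F) (e k)) = true := fun k => by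
    have : e k ∈ Set.range e := ⟨k, rfl⟩
    rw [hr] at this; exact this
  have hinj : Set.InjOn (fun k => e k - 1) (Set.univ) := by
    intro a _ b _ hab
    have := hpos a
    have := hpos b
    apply he.injective
    simp only at hab
    omega
  have hT : ∀ m, T F j (e m - 1) = (Finset.range m).image (fun k => e k - 1) := by
    intro m
    ext i
    simp only [T, Finset.mem_filter, Finset.mem_range, Finset.mem_image]
    rw [← initSeg_qq]
    constructor
    · rintro ⟨hi, hs⟩
      have : i + 1 ∈ Set.range e := by rw [hr]; exact ⟨by omega, hs⟩
      obtain ⟨k, hk⟩ := this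
      exact ⟨k, he.lt_iff_lt.1 (by omega), by omega⟩
    · rintro ⟨k, hk, rfl⟩
      have h1 := he hk
      have h2 := hpos k
      refine ⟨by omega, ?_⟩
      rw [Nat.sub_add_cancel h2.1]; exact h2.2
  have hcard : ∀ m, (T F j (e m - 1)).card = m := by
    intro m
    rw [hT, Finset.card_image_of_injOn (hinj.mono (Set.subset_univ _)), Finset.card_range]
  have hsum : ∀ m, ∑ i ∈ T F j (e m - 1), sg F i = 2 * (Sf (qq F) e m : ℤ) - m := by
    intro m
    rw [hT, Finset.sum_image (hinj.mono (Set.subset_univ _)), Sf]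
    push_cast
    rw [Finset.mul_sum]
    have : ∀ k ∈ Finset.range m, 2 * (bitVal (qq F (e k)) : ℤ) = 1 + sg F (e k - 1) := by
      intro k _
      rw [← bitVal_eq, Nat.sub_add_cancel (hpos k).1]
    rw [Finset.sum_congr rfl this, Finset.sum_add_distrib]
    simp
  rw [Metric.tendsto_atTop]
  intro ε hε
  obtain ⟨D0, hD0⟩ := exists_nat_gt (2 / ε)
  set D := D0 + j + 1 with hDdef
  obtain ⟨K, hK⟩ := main_bound F j D (by omega)
  obtain ⟨m0, hm0⟩ := exists_nat_gt ((K : ℝ) / ε)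
  refine ⟨m0 + 1, fun m hm => ?_⟩
  have hmpos : (0 : ℝ) < m := by exact_mod_cast (by omega : 0 < m)
  have hb := hK (e m - 1)
  rw [hsum, hcard] at hb
  have hb' : |2 * (Sf (qq F) e m : ℝ) - m| * (D + 1) ≤ K + 2 * m := by exact_mod_cast hb
  have hDr : 2 < ε * (D + 1 : ℝ) := by
    rw [div_lt_iff₀ hε] at hD0
    have : (D : ℝ) = D0 + j + 1 := by rw [hDdef]; push_cast; ring
    rw [this]
    have : (0 : ℝ) ≤ j := by positivity
    nlinarith
  have hKm : (K : ℝ) < ε * m := by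
    rw [div_lt_iff₀ hε] at hm0
    have : (m0 : ℝ) ≤ m := by exact_mod_cast (by omega : m0 ≤ m)
    nlinarith
  have hD1 : (1 : ℝ) ≤ D + 1 := by
    have : (0 : ℝ) ≤ D := by positivity
    linarith
  have hX : |2 * (Sf (qq F) e m : ℝ) - m| < 2 * ε * m := by
    have h1 : (K : ℝ) + 2 * m < 2 * ε * m * (D + 1) := by
      have := mul_lt_mul_of_pos_right hDr hmpos
      have := mul_le_mul_of_nonneg_left hD1 (mul_pos hε hmpos).le
      linarith
    exact lt_of_mul_lt_mul_right (hb'.trans_lt h1) (by linarith)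
  rw [Real.dist_eq]
  have : (Sf (qq F) e m : ℝ) / m - 1 / 2 = (2 * (Sf (qq F) e m : ℝ) - m) / (2 * m) := by
    field_simp
  rw [this, abs_div, abs_of_pos (show (0 : ℝ) < 2 * m by linarith), div_lt_iff₀ (by linarith)]
  linarith

lemma S_eq (q : ℕ → Bool) (n : ℕ) : S q n = ∑ k ∈ Finset.range n, bitVal (q (k + 1)) := by
  rw [S, Finset.range_eq_Ico, Finset.sum_Ico_add' (fun i => bitVal (q i)) 0 n 1]
  rfl

end Ville

/-- **Ville's Theorem.** For every countable collection `E` of selection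
functions (maps from finite binary sequences to `{care, don't care}`, with
`true` = care) there is a real `q` such that (1) `S_q(n)/n → 1/2`,
(2) every `f ∈ E` that selects an infinite subsequence of `q` satisfies
`S_{f,q}(m)/m → 1/2`, and (3) `2·S_q(n) ≤ n` for all `n ≥ 1`. -/
theorem ville_theorem (E : Set (List Bool → Bool)) (hE : E.Countable) :
    ∃ q : ℕ → Bool,
      Tendsto (fun n => (S q n : ℝ) / n) atTop (nhds (1 / 2)) ∧
      (∀ f ∈ E, ∀ e : ℕ → ℕ, StrictMono e →
        Set.range e = {n | 1 ≤ n ∧ f (initSeg q n) = true} →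
        Tendsto (fun m => (Sf q e m : ℝ) / m) atTop (nhds (1 / 2))) ∧
      (∀ n : ℕ, 1 ≤ n → 2 * S q n ≤ n) := by
  obtain ⟨F, hF⟩ := (hE.insert (fun _ => true)).exists_eq_range (Set.insert_nonempty _ _)
  have key : ∀ f ∈ insert (fun _ => true) E, ∀ e : ℕ → ℕ, StrictMono e →
        Set.range e = {n | 1 ≤ n ∧ f (initSeg (Ville.qq F) n) = true} →
        Tendsto (fun m => (Sf (Ville.qq F) e m : ℝ) / m) atTop (nhds (1 / 2)) := by
    intro f hf e he hr
    rw [hF] at hf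
    obtain ⟨j, rfl⟩ := hf
    exact Ville.sel_tendsto F j e he hr
  refine ⟨Ville.qq F, ?_, fun f hf => key f (Set.mem_insert_of_mem _ hf), ?_⟩
  · have := key _ (Set.mem_insert _ _) (fun k => k + 1) (fun a b h => by simpa using h) (by
      ext n
      simp only [Set.mem_range, Set.mem_ofPred_eq, and_true]
      exact ⟨by rintro ⟨k, rfl⟩; omega, fun h => ⟨n - 1, by omega⟩⟩)
    simpa only [Ville.S_eq, Sf] using this
  · intro n _
    have h := Ville.total_nonpos F n
    have h2 : 2 * (S (Ville.qq F) n : ℤ) = n + ∑ i ∈ Finset.range n, Ville.sg F i := by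
      rw [Ville.S_eq]
      push_cast
      rw [Finset.mul_sum, Finset.sum_congr rfl (fun k _ => Ville.bitVal_eq F k),
        Finset.sum_add_distrib]
      simp
    omega
end

section
/- Strengthened Ville's Theorem (bounded upward fluctuations): For every countable collection E of selection functions there exists a real q such that (1) lim_{n→∞} S_q(n)/n = 1/2, (2) for every n ≥ 1, 2·S_q(n) ≤ n, (3) for every f ∈ E that selects an infinite subsequence of q, lim_{m→∞} S_{f,q}(m)/m = 1/2, and moreover (4) for every f ∈ E that selects an infinite subsequence of q there is a constant C ≥ 0 (depending on f) with S_{f,q}(m) ≤ m/2 + C for all m ≥ 1. -/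
open Filter

/-- Labels of depth at most `K`. -/
def vT (K : ℕ) : Finset (ℕ × Finset ℕ) := Finset.range (K + 1) ×ˢ (Finset.range K).powerset

/-- Capacity of a label of depth `k`. -/
def vM (k : ℕ) : ℕ := (k + 1) * (vT (k + 1)).card

theorem vM_pos (k : ℕ) : k < vM k := by
  have h : 0 < (vT (k + 1)).card := by
    apply Finset.card_pos.mpr
    exact ⟨(0, ∅), by simp [vT]⟩
  unfold vM
  nlinarith

/-- The label of depth `k` determined by the selection functions. -/
def vLab (g : ℕ → List Bool → Bool) (h : List Bool) (k : ℕ) : ℕ × Finset ℕ :=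
  (k, (Finset.range k).filter (fun j => g j h = true))

/-- The label chosen at a state. -/
noncomputable def vCur (g : ℕ → List Bool → Bool) (s : List Bool × (ℕ × Finset ℕ → ℕ)) :
    ℕ × Finset ℕ :=
  vLab g s.1 (sInf {k | s.2 (vLab g s.1 k) < vM k})

/-- The bit chosen at a state. -/
noncomputable def vBit (g : ℕ → List Bool → Bool) (s : List Bool × (ℕ × Finset ℕ → ℕ)) : Bool :=
  decide (s.2 (vCur g s) % 2 = 1)

/-- The sequence of states. -/
noncomputable def vSt (g : ℕ → List Bool → Bool) : ℕ → List Bool × (ℕ × Finset ℕ → ℕ)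
  | 0 => ([], fun _ => 0)
  | t + 1 => ((vSt g t).1 ++ [vBit g (vSt g t)],
      fun l => (vSt g t).2 l + if vCur g (vSt g t) = l then 1 else 0)

theorem vSt_fst (g : ℕ → List Bool → Bool) (t : ℕ) :
    (vSt g t).1 = (List.range t).map (fun i => vBit g (vSt g i)) := by
  induction t with
  | zero => simp [vSt]
  | succ t ih => rw [List.range_succ, List.map_append, ← ih]; simp [vSt]

theorem vSt_le (g : ℕ → List Bool → Bool) (t : ℕ) (l : ℕ × Finset ℕ) : (vSt g t).2 l ≤ t := by
  induction t with
  | zero => simp [vSt]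
  | succ t ih => simp only [vSt]; split_ifs <;> omega

theorem vCur_lt (g : ℕ → List Bool → Bool) (t : ℕ) :
    (vSt g t).2 (vCur g (vSt g t)) < vM (vCur g (vSt g t)).1 := by
  have hne : {k | (vSt g t).2 (vLab g (vSt g t).1 k) < vM k}.Nonempty :=
    ⟨t, lt_of_le_of_lt (vSt_le g t _) (vM_pos t)⟩
  exact Nat.sInf_mem hne

theorem vCur_prev (g : ℕ → List Bool → Bool) (t k : ℕ) (hk : k < (vCur g (vSt g t)).1) :
    vM k ≤ (vSt g t).2 (vLab g (vSt g t).1 k) := by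
  have := Nat.notMem_of_lt_sInf hk
  simpa using this

theorem vSt_cap (g : ℕ → List Bool → Bool) (t : ℕ) (l : ℕ × Finset ℕ) :
    (vSt g t).2 l ≤ vM l.1 := by
  induction t with
  | zero => simp [vSt]
  | succ t ih =>
    simp only [vSt]
    split_ifs with h
    · have := vCur_lt g t
      rw [h] at this
      omega
    · omega

theorem vSt_card (g : ℕ → List Bool → Bool) (t : ℕ) (l : ℕ × Finset ℕ) :
    (vSt g t).2 l = ((Finset.range t).filter (fun i => vCur g (vSt g i) = l)).card := by
  induction t with
  | zero => simp [vSt]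
  | succ t ih =>
    rw [Finset.range_add_one, Finset.filter_insert]
    simp only [vSt]
    split_ifs with h
    · rw [Finset.card_insert_of_notMem (by simp), ih]
    · rw [ih]; rfl

/-- Signed bit. -/
noncomputable def vX (g : ℕ → List Bool → Bool) (t : ℕ) : ℤ :=
  if vBit g (vSt g t) = true then 1 else -1

theorem vX_fiber (g : ℕ → List Bool → Bool) (n : ℕ) (l : ℕ × Finset ℕ) :
    ∑ i ∈ (Finset.range n).filter (fun i => vCur g (vSt g i) = l), vX g i
      = -(((vSt g n).2 l % 2 : ℕ) : ℤ) := by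
  induction n with
  | zero => simp [vSt]
  | succ t ih =>
    rw [Finset.range_add_one, Finset.filter_insert]
    simp only [vSt]
    split_ifs with h
    · rw [Finset.sum_insert (by simp), ih]
      simp only [vX, vBit, h, decide_eq_true_eq]
      split_ifs with h2 <;> omega
    · simpa using ih

theorem vCur_mem_T (g : ℕ → List Bool → Bool) (i K : ℕ) (h : (vCur g (vSt g i)).1 ≤ K) :
    vCur g (vSt g i) ∈ vT K := by
  simp only [vT, Finset.mem_product, Finset.mem_range, Finset.mem_powerset]
  refine ⟨by omega, ?_⟩
  intro j hj
  have hj' : j < (vCur g (vSt g i)).1 := by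
    simp only [vCur, vLab, Finset.mem_filter, Finset.mem_range] at hj ⊢
    exact hj.1
  simp; omega

theorem vCur_mem (g : ℕ → List Bool → Bool) (i j : ℕ) :
    j ∈ (vCur g (vSt g i)).2 ↔ j < (vCur g (vSt g i)).1 ∧ g j (vSt g i).1 = true := by
  simp only [vCur, vLab, Finset.mem_filter, Finset.mem_range]

/-- Selected times below `n`. -/
noncomputable def vSel (g : ℕ → List Bool → Bool) (j n : ℕ) : Finset ℕ :=
  (Finset.range n).filter (fun i => g j (vSt g i).1 = true)

/-- Times below `n` whose label records that `j` is selected. -/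
noncomputable def vDeep (g : ℕ → List Bool → Bool) (j n : ℕ) : Finset ℕ :=
  (Finset.range n).filter (fun i => j ∈ (vCur g (vSt g i)).2)

/-- The bounded error. -/
def vC (j : ℕ) : ℕ := ∑ l ∈ vT j, vM l.1

theorem vDeep_sub (g : ℕ → List Bool → Bool) (j n : ℕ) : vDeep g j n ⊆ vSel g j n := by
  intro i hi
  simp only [vDeep, vSel, Finset.mem_filter, vCur_mem] at hi ⊢
  exact ⟨hi.1, hi.2.2⟩

theorem vSplit (g : ℕ → List Bool → Bool) (j n : ℕ) :
    |∑ i ∈ vSel g j n, vX g i - ∑ i ∈ vDeep g j n, vX g i| ≤ vC j := by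
  rw [← Finset.sum_sdiff (vDeep_sub g j n), add_sub_cancel_right]
  refine (Finset.abs_sum_le_sum_abs _ _).trans ?_
  have h1 : ∀ i, |vX g i| = 1 := by
    intro i; unfold vX; split_ifs <;> simp
  simp only [h1, Finset.sum_const, nsmul_eq_mul, mul_one, Nat.cast_le]
  rw [Finset.card_eq_sum_card_fiberwise (f := fun i => vCur g (vSt g i)) (t := vT j)]
  · unfold vC
    refine Finset.sum_le_sum fun l _ => ?_
    refine le_trans ?_ (vSt_cap g n l)
    rw [vSt_card]
    apply Finset.card_le_card
    intro i hi
    simp only [vSel, Finset.mem_filter, Finset.mem_sdiff] at hi ⊢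
    exact ⟨hi.1.1.1, hi.2⟩
  · intro i hi
    simp only [vSel, vDeep, Finset.coe_sdiff, Finset.coe_filter, Set.mem_sdiff, Set.mem_ofPred_eq,
      vCur_mem] at hi
    apply vCur_mem_T
    by_contra hc
    exact hi.2 ⟨hi.1.1, by omega, hi.1.2⟩

theorem vDeep_sum (g : ℕ → List Bool → Bool) (j n K : ℕ)
    (hK : ∀ i ∈ vDeep g j n, (vCur g (vSt g i)).1 ≤ K) :
    ∑ i ∈ vDeep g j n, vX g i ≤ 0 ∧ -((vT K).card : ℤ) ≤ ∑ i ∈ vDeep g j n, vX g i := by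
  have hm : ∀ i ∈ vDeep g j n, vCur g (vSt g i) ∈ (vT K).filter (fun l => j ∈ l.2) := by
    intro i hi
    refine Finset.mem_filter.mpr ⟨vCur_mem_T g i K (hK i hi), ?_⟩
    simp only [vDeep, Finset.mem_filter] at hi
    exact hi.2
  rw [← Finset.sum_fiberwise_of_maps_to hm]
  have hf : ∀ l ∈ (vT K).filter (fun l => j ∈ l.2),
      ∑ i ∈ (vDeep g j n).filter (fun i => vCur g (vSt g i) = l), vX g i
        = -(((vSt g n).2 l % 2 : ℕ) : ℤ) := by
    intro l hl
    rw [← vX_fiber]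
    refine Finset.sum_congr ?_ fun _ _ => rfl
    ext i
    simp only [vDeep, Finset.mem_filter] at hl ⊢
    constructor
    · rintro ⟨⟨h1, _⟩, h2⟩; exact ⟨h1, h2⟩
    · rintro ⟨h1, h2⟩; exact ⟨⟨h1, by rw [h2]; exact hl.2⟩, h2⟩
  rw [Finset.sum_congr rfl hf]
  constructor
  · exact Finset.sum_nonpos fun l _ => by omega
  · have h2 : ∑ l ∈ (vT K).filter (fun l => j ∈ l.2), (-1 : ℤ)
        ≤ ∑ l ∈ (vT K).filter (fun l => j ∈ l.2), -(((vSt g n).2 l % 2 : ℕ) : ℤ) :=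
      Finset.sum_le_sum fun l _ => by omega
    refine le_trans ?_ h2
    have := Finset.card_filter_le (vT K) (fun l => j ∈ l.2)
    simp only [Finset.sum_const, nsmul_eq_mul, mul_neg, mul_one, neg_le_neg_iff, Nat.cast_le]
    exact this

theorem vUpper (g : ℕ → List Bool → Bool) (j n : ℕ) : ∑ i ∈ vSel g j n, vX g i ≤ vC j := by
  have h1 := vSplit g j n
  have h2 := (vDeep_sum g j n ((vDeep g j n).sup (fun i => (vCur g (vSt g i)).1))
    (fun i hi => Finset.le_sup (f := fun i => (vCur g (vSt g i)).1) hi)).1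
  have := (abs_le.mp h1).2
  linarith

theorem vAll (g : ℕ → List Bool → Bool) (n : ℕ) : ∑ i ∈ Finset.range n, vX g i ≤ 0 := by
  rw [← Finset.sum_fiberwise_of_maps_to (t := (Finset.range n).image (fun i => vCur g (vSt g i)))
    (g := fun i => vCur g (vSt g i)) (fun i hi => Finset.mem_image_of_mem _ hi)]
  refine Finset.sum_nonpos fun l _ => ?_
  rw [vX_fiber]; omega

theorem vLower (g : ℕ → List Bool → Bool) (j n K0 : ℕ) (hK0 : j + 1 ≤ K0) :
    -((vC j : ℤ) + (vT K0).card) * K0 - (vSel g j n).card ≤ (∑ i ∈ vSel g j n, vX g i) * K0 := by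
  have h1 := (abs_le.mp (vSplit g j n)).1
  by_cases h : ∀ i ∈ vDeep g j n, (vCur g (vSt g i)).1 ≤ K0
  · have h2 := (vDeep_sum g j n K0 h).2
    have h3 : -((vC j : ℤ) + (vT K0).card) ≤ ∑ i ∈ vSel g j n, vX g i := by linarith
    have h4 : (0 : ℤ) ≤ K0 := by positivity
    nlinarith [mul_le_mul_of_nonneg_right h3 h4]
  · push Not at h
    obtain ⟨i0, hi0, hlt⟩ := h
    obtain ⟨i, hi, hmax⟩ := Finset.exists_max_image (vDeep g j n)
      (fun i => (vCur g (vSt g i)).1) ⟨i0, hi0⟩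
    obtain ⟨K, hK⟩ : ∃ K, (vCur g (vSt g i)).1 = K + 1 :=
      ⟨(vCur g (vSt g i)).1 - 1, by have := hmax i0 hi0; omega⟩
    have hKK : K0 ≤ K := by have := hmax i0 hi0; omega
    have h2 := (vDeep_sum g j n (K + 1) (fun i' hi' => hK ▸ hmax i' hi')).2
    have h3 : vM K ≤ (vSel g j n).card := by
      refine (vCur_prev g i K (by omega)).trans ?_
      rw [vSt_card]
      apply Finset.card_le_card
      intro t ht
      apply vDeep_sub
      simp only [vDeep, Finset.mem_filter, Finset.mem_range] at ht hi ⊢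
      refine ⟨by omega, ?_⟩
      rw [ht.2]
      have := (vCur_mem g i j).mp hi.2
      simp only [vLab, Finset.mem_filter, Finset.mem_range]
      exact ⟨by omega, this.2⟩
    have h4 : K0 * (vT (K + 1)).card ≤ (vSel g j n).card := by
      refine le_trans ?_ h3
      unfold vM
      exact Nat.mul_le_mul_right _ (by omega)
    have h4' : (K0 : ℤ) * (vT (K + 1)).card ≤ (vSel g j n).card := by exact_mod_cast h4
    have h5 : (0 : ℤ) ≤ K0 := by positivity
    have h6 : -((vC j : ℤ) + (vT (K + 1)).card) ≤ ∑ i ∈ vSel g j n, vX g i := by linarith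
    have h7 : (0 : ℤ) ≤ (vT K0).card * K0 := by positivity
    nlinarith [mul_le_mul_of_nonneg_right h6 h5]

/-- The real. -/
noncomputable def vQ (g : ℕ → List Bool → Bool) (n : ℕ) : Bool := vBit g (vSt g (n - 1))

theorem vQ_init (g : ℕ → List Bool → Bool) (n : ℕ) : initSeg (vQ g) n = (vSt g (n - 1)).1 := by
  rw [vSt_fst]; simp [initSeg, vQ]

theorem vX_bit (g : ℕ → List Bool → Bool) (n : ℕ) :
    vX g (n - 1) = 2 * (bitVal (vQ g n) : ℤ) - 1 := by
  unfold vX bitVal vQ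
  split_ifs <;> simp

theorem vSel_enum (g : ℕ → List Bool → Bool) (j : ℕ) (e : ℕ → ℕ) (he : StrictMono e)
    (hr : Set.range e = {n | 1 ≤ n ∧ g j (initSeg (vQ g) n) = true}) (m : ℕ) :
    vSel g j (e m - 1) = (Finset.range m).image (fun k => e k - 1) := by
  have hpos : ∀ k, 1 ≤ e k ∧ g j (initSeg (vQ g) (e k)) = true := by
    intro k
    have : e k ∈ Set.range e := ⟨k, rfl⟩
    rw [hr] at this
    exact this
  ext i
  simp only [vSel, Finset.mem_filter, Finset.mem_range, Finset.mem_image]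
  constructor
  · rintro ⟨h1, h2⟩
    have : i + 1 ∈ Set.range e := by
      rw [hr]
      refine ⟨by omega, ?_⟩
      rw [vQ_init]; simpa using h2
    obtain ⟨k, hk⟩ := this
    refine ⟨k, ?_, by omega⟩
    apply he.lt_iff_lt.mp
    omega
  · rintro ⟨k, hk, rfl⟩
    have h1 := he hk
    have h2 := hpos k
    refine ⟨by omega, ?_⟩
    rw [← vQ_init]; exact h2.2

theorem vSf (g : ℕ → List Bool → Bool) (j : ℕ) (e : ℕ → ℕ) (he : StrictMono e)
    (hr : Set.range e = {n | 1 ≤ n ∧ g j (initSeg (vQ g) n) = true}) (m : ℕ) :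
    (vSel g j (e m - 1)).card = m ∧
    ∑ i ∈ vSel g j (e m - 1), vX g i = 2 * (Sf (vQ g) e m : ℤ) - m := by
  have hpos : ∀ k, 1 ≤ e k := by
    intro k
    have : e k ∈ Set.range e := ⟨k, rfl⟩
    rw [hr] at this
    exact this.1
  have hinj : Function.Injective (fun k => e k - 1) := by
    intro a b hab
    have := hpos a
    have := hpos b
    apply he.injective
    simp only at hab
    omega
  rw [vSel_enum g j e he hr m]
  refine ⟨by rw [Finset.card_image_of_injective _ hinj, Finset.card_range], ?_⟩
  rw [Finset.sum_image (fun a _ b _ h => hinj h)]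
  simp only [vX_bit, Sf, Finset.sum_sub_distrib, ← Finset.mul_sum]
  simp

theorem vUp (g : ℕ → List Bool → Bool) (j : ℕ) (e : ℕ → ℕ) (he : StrictMono e)
    (hr : Set.range e = {n | 1 ≤ n ∧ g j (initSeg (vQ g) n) = true}) (m : ℕ) :
    (Sf (vQ g) e m : ℝ) ≤ m / 2 + vC j := by
  have h := vUpper g j (e m - 1)
  rw [(vSf g j e he hr m).2] at h
  have h' : 2 * (Sf (vQ g) e m : ℝ) - m ≤ vC j := by exact_mod_cast h
  have : (0 : ℝ) ≤ vC j := by positivity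
  linarith

theorem vLim (g : ℕ → List Bool → Bool) (j : ℕ) (e : ℕ → ℕ) (he : StrictMono e)
    (hr : Set.range e = {n | 1 ≤ n ∧ g j (initSeg (vQ g) n) = true}) :
    Tendsto (fun m => (Sf (vQ g) e m : ℝ) / m) atTop (nhds (1 / 2)) := by
  rw [Metric.tendsto_atTop]
  intro ε hε
  obtain ⟨K1, hK1⟩ := exists_nat_gt (1 / ε)
  obtain ⟨K0, hK0, hKj⟩ : ∃ K0 : ℕ, 1 / ε < K0 ∧ j + 1 ≤ K0 :=
    ⟨max K1 (j + 1), lt_of_lt_of_le hK1 (by exact_mod_cast le_max_left _ _), le_max_right _ _⟩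
  obtain ⟨N, hN⟩ := exists_nat_gt (((vC j : ℝ) + (vT K0).card) / ε)
  refine ⟨N + 1, fun m hm => ?_⟩
  have hmpos : (0 : ℝ) < m := by exact_mod_cast (by omega : 0 < m)
  have hNm : (N : ℝ) ≤ m := by exact_mod_cast (by omega : N ≤ m)
  have hKpos : (0 : ℝ) < K0 := by exact_mod_cast (by omega : 0 < K0)
  have hup := vUp g j e he hr m
  have hlow := vLower g j (e m - 1) K0 hKj
  rw [(vSf g j e he hr m).2, (vSf g j e he hr m).1] at hlow
  have hlow' : -((vC j : ℝ) + (vT K0).card) * K0 - m ≤ (2 * (Sf (vQ g) e m : ℝ) - m) * K0 := by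
    exact_mod_cast hlow
  have hA : (vC j : ℝ) + (vT K0).card < ε * m := by
    rw [div_lt_iff₀ hε] at hN
    nlinarith
  have hB : 1 < ε * K0 := by
    rw [div_lt_iff₀ hε] at hK0
    linarith
  have hT : (0 : ℝ) ≤ (vT K0).card := by positivity
  have hmB : (m : ℝ) < ε * m * K0 := by nlinarith
  have hlow2 : -(2 * ε * m) < 2 * (Sf (vQ g) e m : ℝ) - m := by
    by_contra hc
    push Not at hc
    nlinarith [mul_le_mul_of_nonneg_right hc hKpos.le, mul_lt_mul_of_pos_right hA hKpos]
  rw [Real.dist_eq, abs_lt]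
  constructor
  · rw [lt_sub_iff_add_lt, lt_div_iff₀ hmpos]; linarith
  · rw [sub_lt_iff_lt_add, div_lt_iff₀ hmpos]; linarith

/-- **Strengthened Ville's Theorem (bounded upward fluctuations).** -/
theorem ville_theorem_bounded_upward (E : Set (List Bool → Bool)) (hE : E.Countable) :
    ∃ q : ℕ → Bool,
      Tendsto (fun n => (S q n : ℝ) / n) atTop (nhds (1 / 2)) ∧
      (∀ n : ℕ, 1 ≤ n → 2 * S q n ≤ n) ∧
      (∀ f ∈ E, ∀ e : ℕ → ℕ, StrictMono e →
        Set.range e = {n | 1 ≤ n ∧ f (initSeg q n) = true} →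
        Tendsto (fun m => (Sf q e m : ℝ) / m) atTop (nhds (1 / 2))) ∧
      (∀ f ∈ E, ∀ e : ℕ → ℕ, StrictMono e →
        Set.range e = {n | 1 ≤ n ∧ f (initSeg q n) = true} →
        ∃ C : ℝ, 0 ≤ C ∧ ∀ m : ℕ, 1 ≤ m → (Sf q e m : ℝ) ≤ m / 2 + C) := by
  obtain ⟨g, hg⟩ := (hE.insert (fun _ => true)).exists_eq_range (Set.insert_nonempty _ _)
  have hall : ∃ j, g j = fun _ => true := by
    have : (fun _ => true) ∈ Set.range g := by rw [← hg]; exact Set.mem_insert _ _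
    exact this
  have hmem : ∀ f ∈ E, ∃ j, g j = f := by
    intro f hf
    have : f ∈ Set.range g := by rw [← hg]; exact Set.mem_insert_of_mem _ hf
    exact this
  have hS : ∀ n, S (vQ g) n = Sf (vQ g) (fun k => k + 1) n := by
    intro n
    unfold S Sf
    rw [Finset.sum_bij' (i := fun i _ => i - 1) (j := fun k _ => k + 1)] <;>
      simp +contextual
    all_goals grind
  refine ⟨vQ g, ?_, ?_, ?_, ?_⟩
  · obtain ⟨j, hj⟩ := hall
    simp only [hS]
    refine vLim g j _ (fun a b h => by simpa using h) ?_
    ext n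
    simp only [hj, Set.mem_range, Set.mem_ofPred_eq, and_true]
    exact ⟨by rintro ⟨k, rfl⟩; omega, fun h => ⟨n - 1, by omega⟩⟩
  · intro n _
    have h := vAll g n
    have h2 : ∀ i, vX g i = 2 * (bitVal (vQ g (i + 1)) : ℤ) - 1 := fun i => vX_bit g (i + 1)
    simp only [h2, Finset.sum_sub_distrib, ← Finset.mul_sum] at h
    rw [hS]
    unfold Sf
    zify
    simpa using h
  · intro f hf e he hr
    obtain ⟨j, rfl⟩ := hmem f hf
    exact vLim g j e he hr
  · intro f hf e he hr
    obtain ⟨j, rfl⟩ := hmem f hf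
    exact ⟨vC j, by positivity, fun m _ => vUp g j e he hr m⟩
end

section
/- Ville's Theorem with power-law fluctuation bound: For every countable collection E of selection functions there exists a real q such that (1) lim_{n→∞} S_q(n)/n = 1/2, (2) for every n ≥ 1, 2·S_q(n) ≤ n, and (3) for every f ∈ E that selects an infinite subsequence of q there are constants C₁, C₂ ≥ 0 (depending on f) such that for all m ≥ 1, m/2 − C₂·m^{ln 2 / ln 3} ≤ S_{f,q}(m) ≤ m/2 + C₁. -/
open Filter

/-- number of visits of node `v` before time `t` -/
def vcnt (nd : ℕ → List Bool) (t : ℕ) (v : List Bool) : ℕ :=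
  ((Finset.range t).filter (fun s => nd s = v)).card

def vpath (f : ℕ → List Bool → Bool) (h : List Bool) (d : ℕ) : List Bool :=
  (List.range d).map (fun i => f i h)

noncomputable def vnode (f : ℕ → List Bool → Bool) (x : List Bool × (List Bool → ℕ)) : List Bool :=
  vpath f x.1 (sInf {d | x.2 (vpath f x.1 d) < 4 ^ (d + 1)})

noncomputable def vstate (f : ℕ → List Bool → Bool) : ℕ → List Bool × (List Bool → ℕ)
  | 0 => ([], fun _ => 0)
  | t + 1 =>
    ((vstate f t).1 ++ [decide ((vstate f t).2 (vnode f (vstate f t)) % 2 = 1)],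
      Function.update (vstate f t).2 (vnode f (vstate f t))
        ((vstate f t).2 (vnode f (vstate f t)) + 1))

theorem vcnt_succ (nd : ℕ → List Bool) (t : ℕ) (v : List Bool) :
    vcnt nd (t + 1) v = vcnt nd t v + if nd t = v then 1 else 0 := by
  unfold vcnt
  rw [Finset.range_add_one, Finset.filter_insert]
  split_ifs with h
  · rw [Finset.card_insert_of_notMem (by simp)]
  · simp

theorem vcnt_le (nd : ℕ → List Bool) (t : ℕ) (v : List Bool) : vcnt nd t v ≤ t := by
  unfold vcnt
  exact (Finset.card_filter_le _ _).trans (by simp)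

theorem vcnt_mono (nd : ℕ → List Bool) {s t : ℕ} (h : s ≤ t) (v : List Bool) :
    vcnt nd s v ≤ vcnt nd t v := by
  unfold vcnt
  apply Finset.card_le_card
  apply Finset.filter_subset_filter
  simpa using h

theorem vpath_length (f : ℕ → List Bool → Bool) (h : List Bool) (d : ℕ) :
    (vpath f h d).length = d := by simp [vpath]

theorem vpath_dropLast (f : ℕ → List Bool → Bool) (h : List Bool) (d : ℕ) :
    (vpath f h (d + 1)).dropLast = vpath f h d := by
  simp [vpath, List.range_succ]

theorem ville_construct (f : ℕ → List Bool → Bool) : ∃ (q : ℕ → Bool) (nd : ℕ → List Bool),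
    (∀ t, ∃ d, nd t = vpath f (initSeg q (t + 1)) d ∧ vcnt nd t (nd t) < 4 ^ (d + 1) ∧
      ∀ i < d, 4 ^ (i + 1) ≤ vcnt nd t (vpath f (initSeg q (t + 1)) i)) ∧
    ∀ t, q (t + 1) = decide (vcnt nd t (nd t) % 2 = 1) := by
  set nd : ℕ → List Bool := fun t => vnode f (vstate f t) with hnd
  set q : ℕ → Bool := fun n => decide ((vstate f (n - 1)).2 (nd (n - 1)) % 2 = 1) with hq
  have h1 : ∀ t, (vstate f t).1 = initSeg q (t + 1) := by
    intro t
    induction t with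
    | zero => simp [vstate, initSeg]
    | succ t ih =>
      have : initSeg q (t + 1 + 1) = initSeg q (t + 1) ++ [q (t + 1)] := by
        simp [initSeg, List.range_succ]
      rw [this, ← ih]
      simp [vstate, hq, hnd]
  have h2 : ∀ t v, (vstate f t).2 v = vcnt nd t v := by
    intro t
    induction t with
    | zero => intro v; simp [vstate, vcnt]
    | succ t ih =>
      intro v
      rw [vcnt_succ, ← ih]
      simp only [vstate, Function.update_apply, hnd]
      by_cases h : v = vnode f (vstate f t)
      · simp [h]
      · simp [h, Ne.symm h]
  refine ⟨q, nd, fun t => ?_, fun t => ?_⟩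
  · set D := {d | (vstate f t).2 (vpath f (vstate f t).1 d) < 4 ^ (d + 1)} with hD
    have hne : D.Nonempty := by
      refine ⟨t, ?_⟩
      simp only [hD, Set.mem_ofPred_eq, h2]
      calc _ ≤ t := vcnt_le _ _ _
        _ < 4 ^ t := Nat.lt_pow_self (by norm_num)
        _ ≤ _ := Nat.pow_le_pow_right (by norm_num) (by omega)
    have hn : nd t = vpath f (initSeg q (t + 1)) (sInf D) := by
      rw [← h1]; rfl
    refine ⟨sInf D, hn, ?_, ?_⟩
    · have := Nat.sInf_mem hne
      rw [hn]
      simpa only [hD, Set.mem_ofPred_eq, h2, h1] using this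
    · intro i hi
      have := Nat.notMem_of_lt_sInf hi
      simpa only [hD, Set.mem_ofPred_eq, h2, h1, not_lt] using this
  · simp [hq, h2]

theorem card_lists (K : ℕ) (s : Finset (List Bool)) (hs : ∀ v ∈ s, v.length ≤ K) :
    s.card ≤ 2 ^ (K + 1) := by
  have : s ⊆ (Finset.range (K + 1)).biUnion
      (fun d => (Finset.univ : Finset (Fin d → Bool)).image List.ofFn) := by
    intro v hv
    simp only [Finset.mem_biUnion, Finset.mem_range, Finset.mem_image, Finset.mem_univ, true_and]
    exact ⟨v.length, by have := hs v hv; omega, v.get, by simp⟩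
  refine (Finset.card_le_card this).trans (Finset.card_biUnion_le.trans ?_)
  calc _ ≤ ∑ d ∈ Finset.range (K + 1), 2 ^ d := by
        apply Finset.sum_le_sum
        intro d _
        exact Finset.card_image_le.trans (by simp)
    _ ≤ 2 ^ (K + 1) := by
        have := Nat.geomSum_eq (le_refl 2) (K + 1)
        rw [this]; simp

section
variable {f : ℕ → List Bool → Bool} {q : ℕ → Bool} {nd : ℕ → List Bool}

theorem ville_half (h2 : ∀ t, q (t + 1) = decide (vcnt nd t (nd t) % 2 = 1)) (t : ℕ)
    (v : List Bool) :
    ((Finset.range t).filter (fun s => nd s = v ∧ q (s + 1) = true)).card = vcnt nd t v / 2 := by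
  induction t with
  | zero => simp [vcnt]
  | succ t ih =>
    rw [vcnt_succ, Finset.range_add_one, Finset.filter_insert]
    by_cases h : nd t = v
    · have h3 := h2 t
      rw [h] at h3
      by_cases h4 : vcnt nd t v % 2 = 1
      · rw [if_pos ⟨h, by simp [h3, h4]⟩, Finset.card_insert_of_notMem (by simp), ih, if_pos h]
        omega
      · rw [if_neg (by simp [h3, h4]), ih, if_pos h]
        omega
    · rw [if_neg (by simp [h]), ih, if_neg h, add_zero]

theorem ville_cap
    (h1 : ∀ t, ∃ d, nd t = vpath f (initSeg q (t + 1)) d ∧ vcnt nd t (nd t) < 4 ^ (d + 1) ∧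
      ∀ i < d, 4 ^ (i + 1) ≤ vcnt nd t (vpath f (initSeg q (t + 1)) i)) (t : ℕ) (v : List Bool) :
    vcnt nd t v ≤ 4 ^ (v.length + 1) := by
  induction t with
  | zero => simp [vcnt]
  | succ t ih =>
    rw [vcnt_succ]
    split_ifs with h
    · obtain ⟨d, hd, h3, -⟩ := h1 t
      have : v.length = d := by rw [← h, hd, vpath_length]
      rw [h] at h3; rw [this]; exact h3
    · exact ih

theorem ville_parent
    (h1 : ∀ t, ∃ d, nd t = vpath f (initSeg q (t + 1)) d ∧ vcnt nd t (nd t) < 4 ^ (d + 1) ∧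
      ∀ i < d, 4 ^ (i + 1) ≤ vcnt nd t (vpath f (initSeg q (t + 1)) i)) (s t : ℕ) (hst : s < t)
    (hl : 0 < (nd s).length) :
    4 ^ (nd s).length ≤ vcnt nd t (nd s).dropLast := by
  obtain ⟨d, hd, -, h3⟩ := h1 s
  rw [hd, vpath_length] at hl
  rw [hd, vpath_length]
  obtain ⟨d, rfl⟩ : ∃ e, d = e + 1 := ⟨d - 1, by omega⟩
  rw [vpath_dropLast]
  exact (h3 d (by omega)).trans (vcnt_mono nd hst.le _)

theorem ville_G
    (h1 : ∀ t, ∃ d, nd t = vpath f (initSeg q (t + 1)) d ∧ vcnt nd t (nd t) < 4 ^ (d + 1) ∧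
      ∀ i < d, 4 ^ (i + 1) ≤ vcnt nd t (vpath f (initSeg q (t + 1)) i))
    (h2 : ∀ t, q (t + 1) = decide (vcnt nd t (nd t) % 2 = 1))
    (G : List Bool → Prop) [DecidablePred G] (J : ℕ) (hG : ∀ v, G v → J < v.length → G v.dropLast) (t k : ℕ)
    (hk : ((Finset.range t).filter (fun s => G (nd s))).card ≤ 4 ^ (k + 1)) :
    2 * ((Finset.range t).filter (fun s => G (nd s) ∧ q (s + 1) = true)).card
      ≤ ((Finset.range t).filter (fun s => G (nd s))).card ∧
    ((Finset.range t).filter (fun s => G (nd s))).card ≤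
      2 * ((Finset.range t).filter (fun s => G (nd s) ∧ q (s + 1) = true)).card
      + (2 ^ (max k J + 1) + 2) := by
  set V := ((Finset.range t).image nd).filter G with hV
  have hM : ((Finset.range t).filter (fun s => G (nd s))).card = ∑ v ∈ V, vcnt nd t v := by
    rw [Finset.card_eq_sum_card_fiberwise (f := nd) (t := V)]
    · apply Finset.sum_congr rfl
      intro v hv
      unfold vcnt
      congr 1
      ext s
      simp only [hV, Finset.mem_filter] at hv ⊢
      constructor
      · rintro ⟨⟨a, b⟩, c⟩; exact ⟨a, c⟩
      · rintro ⟨a, c⟩; exact ⟨⟨a, c ▸ hv.2⟩, c⟩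
    · intro s hs
      simp only [hV, Finset.coe_filter, Finset.mem_range, Set.mem_ofPred_eq, Finset.mem_image] at hs ⊢
      exact ⟨⟨s, hs.1, rfl⟩, hs.2⟩
  have hQ : ((Finset.range t).filter (fun s => G (nd s) ∧ q (s + 1) = true)).card
      = ∑ v ∈ V, vcnt nd t v / 2 := by
    rw [Finset.card_eq_sum_card_fiberwise (f := nd) (t := V)]
    · apply Finset.sum_congr rfl
      intro v hv
      rw [← ville_half h2]
      congr 1
      ext s
      simp only [hV, Finset.mem_filter] at hv ⊢
      constructor
      · rintro ⟨⟨a, b, d⟩, c⟩; exact ⟨a, c, d⟩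
      · rintro ⟨a, c, d⟩; exact ⟨⟨a, c ▸ hv.2, d⟩, c⟩
    · intro s hs
      simp only [hV, Finset.coe_filter, Finset.mem_range, Set.mem_ofPred_eq, Finset.mem_image] at hs ⊢
      exact ⟨⟨s, hs.1, rfl⟩, hs.2.1⟩
  have hD : ∑ v ∈ V, vcnt nd t v ≤ 2 * ∑ v ∈ V, vcnt nd t v / 2 + V.card := by
    rw [Finset.mul_sum, Finset.card_eq_sum_ones, ← Finset.sum_add_distrib]
    apply Finset.sum_le_sum
    intro v _
    omega
  have hle : 2 * ∑ v ∈ V, vcnt nd t v / 2 ≤ ∑ v ∈ V, vcnt nd t v := by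
    rw [Finset.mul_sum]
    apply Finset.sum_le_sum
    intro v _
    omega
  have hsplit : V.card = (V.filter (fun v => v.length ≤ max k J)).card
      + (V.filter (fun v => ¬ v.length ≤ max k J)).card :=
    (Finset.card_filter_add_card_filter_not _).symm
  have hA : (V.filter (fun v => v.length ≤ max k J)).card ≤ 2 ^ (max k J + 1) :=
    card_lists _ _ (fun v hv => (Finset.mem_filter.1 hv).2)
  -- the deep nodes
  set W := V.filter (fun v => ¬ v.length ≤ max k J) with hW
  set P := W.image List.dropLast with hP
  have hWP : W.card ≤ 2 * P.card := by
    have := Finset.card_le_mul_card_image (f := List.dropLast) W 2 (by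
      intro u hu
      have : W.filter (fun v => v.dropLast = u) ⊆ {u ++ [true], u ++ [false]} := by
        intro v hv
        simp only [Finset.mem_filter, hW] at hv
        have hne : v ≠ [] := by
          rintro rfl
          simp at hv
        have h := List.dropLast_append_getLast hne
        rw [hv.2] at h
        rw [← h]
        cases v.getLast hne <;> simp
      exact (Finset.card_le_card this).trans Finset.card_le_two)
    exact this
  have hPV : ∀ u ∈ P, u ∈ V ∧ 4 ^ (k + 1) ≤ vcnt nd t u := by
    intro u hu
    simp only [hP, hW, hV, Finset.mem_image, Finset.mem_filter, Finset.mem_range] at hu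
    obtain ⟨v, ⟨⟨⟨s, hs, rfl⟩, hg⟩, hl⟩, rfl⟩ := hu
    have hl' : k < (nd s).length ∧ J < (nd s).length := by
      rw [not_le, max_lt_iff] at hl; exact hl
    have hp := ville_parent h1 s t hs (by omega)
    have hp' : 4 ^ (k + 1) ≤ vcnt nd t (nd s).dropLast :=
      (Nat.pow_le_pow_right (by norm_num) (by omega)).trans hp
    refine ⟨?_, hp'⟩
    simp only [hV, Finset.mem_filter, Finset.mem_image, Finset.mem_range]
    refine ⟨?_, hG _ hg hl'.2⟩
    have : 0 < vcnt nd t (nd s).dropLast := lt_of_lt_of_le (by positivity) hp'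
    unfold vcnt at this
    obtain ⟨r, hr⟩ := Finset.card_pos.1 this
    simp only [Finset.mem_filter, Finset.mem_range] at hr
    exact ⟨r, hr.1, hr.2⟩
  have hPc : P.card * 4 ^ (k + 1) ≤ 4 ^ (k + 1) := by
    calc P.card * 4 ^ (k + 1) = ∑ u ∈ P, 4 ^ (k + 1) := by simp
      _ ≤ ∑ u ∈ P, vcnt nd t u := Finset.sum_le_sum (fun u hu => (hPV u hu).2)
      _ ≤ ∑ u ∈ V, vcnt nd t u :=
        Finset.sum_le_sum_of_subset (fun u hu => (hPV u hu).1)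
      _ ≤ _ := hM ▸ hk
  have hP1 : P.card ≤ 1 := by
    by_contra h
    have : 0 < 4 ^ (k + 1) := by positivity
    nlinarith
  rw [hM, hQ]
  omega

/-- visits to shallow nodes are bounded -/
theorem ville_shallow
    (h1 : ∀ t, ∃ d, nd t = vpath f (initSeg q (t + 1)) d ∧ vcnt nd t (nd t) < 4 ^ (d + 1) ∧
      ∀ i < d, 4 ^ (i + 1) ≤ vcnt nd t (vpath f (initSeg q (t + 1)) i)) (j t : ℕ) :
    ((Finset.range t).filter (fun s => (nd s).length ≤ j)).card ≤ 2 ^ (j + 1) * 4 ^ (j + 1) := by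
  set V := ((Finset.range t).image nd).filter (fun v => v.length ≤ j) with hV
  have hc : V.card ≤ 2 ^ (j + 1) := card_lists _ _ (fun v hv => (Finset.mem_filter.1 hv).2)
  have := Finset.card_le_mul_card_image_of_maps_to (f := nd)
    (s := (Finset.range t).filter (fun s => (nd s).length ≤ j)) (t := V) (by
      intro s hs
      simp only [hV, Finset.mem_filter, Finset.mem_image] at hs ⊢
      exact ⟨⟨s, hs.1, rfl⟩, hs.2⟩) (4 ^ (j + 1)) (by
      intro v hv
      calc _ ≤ vcnt nd t v := by
            unfold vcnt
            apply Finset.card_le_card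
            intro s hs
            simp only [Finset.mem_filter] at hs ⊢
            exact ⟨hs.1.1, hs.2⟩
        _ ≤ 4 ^ (v.length + 1) := ville_cap h1 t v
        _ ≤ _ := Nat.pow_le_pow_right (by norm_num) (by
            have := (Finset.mem_filter.1 hv).2
            omega))
  calc _ ≤ 4 ^ (j + 1) * V.card := this
    _ ≤ 4 ^ (j + 1) * 2 ^ (j + 1) := Nat.mul_le_mul_left _ hc
    _ = _ := by ring

/-- the bounds for the selection function `f j` -/
theorem ville_sel
    (h1 : ∀ t, ∃ d, nd t = vpath f (initSeg q (t + 1)) d ∧ vcnt nd t (nd t) < 4 ^ (d + 1) ∧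
      ∀ i < d, 4 ^ (i + 1) ≤ vcnt nd t (vpath f (initSeg q (t + 1)) i))
    (h2 : ∀ t, q (t + 1) = decide (vcnt nd t (nd t) % 2 = 1)) (j : ℕ) :
    ∃ C : ℕ, ∀ t k,
    ((Finset.range t).filter (fun s => f j (initSeg q (s + 1)) = true)).card ≤ 4 ^ (k + 1) →
    2 * ((Finset.range t).filter
        (fun s => f j (initSeg q (s + 1)) = true ∧ q (s + 1) = true)).card
      ≤ ((Finset.range t).filter (fun s => f j (initSeg q (s + 1)) = true)).card + C ∧
    ((Finset.range t).filter (fun s => f j (initSeg q (s + 1)) = true)).card ≤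
      2 * ((Finset.range t).filter
        (fun s => f j (initSeg q (s + 1)) = true ∧ q (s + 1) = true)).card
      + 2 * 2 ^ k + C := by
  classical
  set G : List Bool → Prop := fun v => v[j]? = some true with hGdef
  have hG : ∀ v, G v → j + 1 < v.length → G v.dropLast := by
    intro v hv hl
    simp only [hGdef] at hv ⊢
    rw [List.getElem?_dropLast, if_pos (by omega)]
    exact hv
  have hGs : ∀ s, j < (nd s).length → (G (nd s) ↔ f j (initSeg q (s + 1)) = true) := by
    intro s hs
    obtain ⟨d, hd, -⟩ := h1 s
    rw [hd, vpath_length] at hs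
    simp [hGdef, hd, vpath, hs]
  have hGl : ∀ v, G v → j < v.length := by
    intro v hv
    by_contra h
    simp [hGdef, List.getElem?_eq_none (not_lt.1 h)] at hv
  set C := 2 ^ (j + 1) * 4 ^ (j + 1) with hC
  refine ⟨2 * C + 2 + 2 * 2 ^ (j + 1), fun t k hk => ?_⟩
  have hsh := ville_shallow h1 j t
  have a1 : (Finset.range t).filter (fun s => G (nd s)) ⊆
      (Finset.range t).filter (fun s => f j (initSeg q (s + 1)) = true) := by
    intro s hs
    simp only [Finset.mem_filter] at hs ⊢
    exact ⟨hs.1, (hGs s (hGl _ hs.2)).1 hs.2⟩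
  have a2 : (Finset.range t).filter (fun s => G (nd s) ∧ q (s + 1) = true) ⊆
      (Finset.range t).filter (fun s => f j (initSeg q (s + 1)) = true ∧ q (s + 1) = true) := by
    intro s hs
    simp only [Finset.mem_filter] at hs ⊢
    exact ⟨hs.1, (hGs s (hGl _ hs.2.1)).1 hs.2.1, hs.2.2⟩
  have a3 : (Finset.range t).filter (fun s => f j (initSeg q (s + 1)) = true) ⊆
      (Finset.range t).filter (fun s => G (nd s)) ∪
      (Finset.range t).filter (fun s => (nd s).length ≤ j) := by
    intro s hs
    simp only [Finset.mem_filter, Finset.mem_union] at hs ⊢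
    by_cases h : (nd s).length ≤ j
    · exact Or.inr ⟨hs.1, h⟩
    · exact Or.inl ⟨hs.1, (hGs s (not_le.1 h)).2 hs.2⟩
  have a4 : (Finset.range t).filter
        (fun s => f j (initSeg q (s + 1)) = true ∧ q (s + 1) = true) ⊆
      (Finset.range t).filter (fun s => G (nd s) ∧ q (s + 1) = true) ∪
      (Finset.range t).filter (fun s => (nd s).length ≤ j) := by
    intro s hs
    simp only [Finset.mem_filter, Finset.mem_union] at hs ⊢
    by_cases h : (nd s).length ≤ j
    · exact Or.inr ⟨hs.1, h⟩
    · exact Or.inl ⟨hs.1, (hGs s (not_le.1 h)).2 hs.2.1, hs.2.2⟩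
  have b1 := Finset.card_le_card a1
  have b2 := Finset.card_le_card a2
  have b3 := (Finset.card_le_card a3).trans (Finset.card_union_le _ _)
  have b4 := (Finset.card_le_card a4).trans (Finset.card_union_le _ _)
  have hg := ville_G h1 h2 G (j + 1) hG t k (b1.trans hk)
  have hpow : 2 ^ (max k (j + 1) + 1) ≤ 2 * 2 ^ k + 2 * 2 ^ (j + 1) := by
    rw [pow_succ]
    rcases max_choice k (j + 1) with h | h <;> rw [h] <;> omega
  have g1 := hg.1
  have g2 := hg.2
  constructor
  · omega
  · omega

end

theorem ville_pow (m : ℕ) (hm : 1 ≤ m) :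
    ((2 ^ Nat.log 4 m : ℕ) : ℝ) ≤ (m : ℝ) ^ (Real.log 2 / Real.log 3) := by
  have h3 : 0 < Real.log 3 := Real.log_pos (by norm_num)
  have hα : (1 / 2 : ℝ) ≤ Real.log 2 / Real.log 3 := by
    rw [le_div_iff₀ h3]
    have h4 : Real.log 3 ≤ Real.log (2 ^ 2) := Real.log_le_log (by norm_num) (by norm_num)
    rw [Real.log_pow] at h4
    push_cast at h4
    linarith
  have hm' : (1 : ℝ) ≤ m := by exact_mod_cast hm
  refine le_trans ?_ (Real.rpow_le_rpow_of_exponent_le hm' hα)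
  rw [← Real.sqrt_eq_rpow]
  apply Real.le_sqrt_of_sq_le
  have : (2 ^ Nat.log 4 m) ^ 2 ≤ m := by
    rw [← pow_mul, mul_comm, pow_mul]
    exact Nat.pow_log_le_self 4 (by omega)
  exact_mod_cast this

/-- counting along the enumeration -/
theorem ville_enum (q : ℕ → Bool) (g : ℕ → Bool) (e : ℕ → ℕ) (he : StrictMono e)
    (hr : Set.range e = {n | 1 ≤ n ∧ g n = true}) (m : ℕ) :
    ∃ t, ((Finset.range t).filter (fun s => g (s + 1) = true)).card = m ∧
      ((Finset.range t).filter (fun s => g (s + 1) = true ∧ q (s + 1) = true)).card = Sf q e m := by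
  have hmem : ∀ k, 1 ≤ e k ∧ g (e k) = true := fun k => by
    have : e k ∈ Set.range e := ⟨k, rfl⟩
    rwa [hr] at this
  have hinj : Set.InjOn (fun k => e k - 1) (Finset.range m) := by
    intro a _ b _ hab
    have := hmem a
    have := hmem b
    simp only at hab
    exact he.injective (by omega)
  have himg : (Finset.range (e m - 1)).filter (fun s => g (s + 1) = true)
      = (Finset.range m).image (fun k => e k - 1) := by
    ext s
    simp only [Finset.mem_filter, Finset.mem_range, Finset.mem_image]
    constructor
    · rintro ⟨h1, h2⟩
      have : s + 1 ∈ Set.range e := by rw [hr]; exact ⟨by omega, h2⟩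
      obtain ⟨k, hk⟩ := this
      exact ⟨k, he.lt_iff_lt.1 (by omega), by omega⟩
    · rintro ⟨k, hk, rfl⟩
      have h1 := hmem k
      have h2 := he hk
      refine ⟨by omega, ?_⟩
      rw [Nat.sub_add_cancel h1.1]
      exact h1.2
  refine ⟨e m - 1, ?_, ?_⟩
  · rw [himg, Finset.card_image_of_injOn hinj, Finset.card_range]
  · rw [← Finset.filter_filter, himg, Finset.card_filter, Finset.sum_image hinj]
    unfold Sf bitVal
    apply Finset.sum_congr rfl
    intro k _
    simp only [Nat.sub_add_cancel (hmem k).1]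

theorem S_eq_Sf (q : ℕ → Bool) (n : ℕ) : S q n = Sf q (fun k => k + 1) n := by
  unfold S Sf
  rw [Finset.range_eq_Ico, Finset.sum_Ico_add' (fun i => bitVal (q i)) 0 n 1]
  rfl

/-- **Ville's Theorem with power-law fluctuation bound.** -/
theorem ville_theorem_power_law (E : Set (List Bool → Bool)) (hE : E.Countable) :
    ∃ q : ℕ → Bool,
      Tendsto (fun n => (S q n : ℝ) / n) atTop (nhds (1 / 2)) ∧
      (∀ n : ℕ, 1 ≤ n → 2 * S q n ≤ n) ∧
      (∀ f ∈ E, ∀ e : ℕ → ℕ, StrictMono e →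
        Set.range e = {n | 1 ≤ n ∧ f (initSeg q n) = true} →
        ∃ C₁ C₂ : ℝ, 0 ≤ C₁ ∧ 0 ≤ C₂ ∧ ∀ m : ℕ, 1 ≤ m →
          (m : ℝ) / 2 - C₂ * (m : ℝ) ^ (Real.log 2 / Real.log 3) ≤ (Sf q e m : ℝ) ∧
          (Sf q e m : ℝ) ≤ m / 2 + C₁) := by
  classical
  have hne : (insert (fun _ => true) E : Set (List Bool → Bool)).Nonempty := ⟨_, Set.mem_insert _ _⟩
  obtain ⟨f, hf⟩ := (hE.insert (fun _ => true)).exists_eq_range hne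
  obtain ⟨q, nd, h1, h2⟩ := ville_construct f
  have key : ∀ g ∈ (insert (fun _ => true) E : Set (List Bool → Bool)),
      ∀ e : ℕ → ℕ, StrictMono e →
        Set.range e = {n | 1 ≤ n ∧ g (initSeg q n) = true} →
        ∃ C₁ C₂ : ℝ, 0 ≤ C₁ ∧ 0 ≤ C₂ ∧ ∀ m : ℕ, 1 ≤ m →
          (m : ℝ) / 2 - C₂ * (m : ℝ) ^ (Real.log 2 / Real.log 3) ≤ (Sf q e m : ℝ) ∧
          (Sf q e m : ℝ) ≤ m / 2 + C₁ := by
    intro g hg e he hr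
    rw [hf] at hg
    obtain ⟨j, rfl⟩ := hg
    obtain ⟨C, hC⟩ := ville_sel h1 h2 j
    refine ⟨C, C + 1, by positivity, by positivity, fun m hm => ?_⟩
    obtain ⟨t, ht1, ht2⟩ := ville_enum q (fun n => f j (initSeg q n)) e he hr m
    have := hC t (Nat.log 4 m) (by
      rw [ht1]; exact (Nat.lt_pow_succ_log_self (by norm_num) m).le)
    rw [ht1, ht2] at this
    obtain ⟨u1, u2⟩ := this
    have hp := ville_pow m hm
    have hone : (1 : ℝ) ≤ (m : ℝ) ^ (Real.log 2 / Real.log 3) :=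
      le_trans (by exact_mod_cast Nat.one_le_two_pow) hp
    have v1 : (2 : ℝ) * Sf q e m ≤ m + C := by exact_mod_cast u1
    have v2 : (m : ℝ) ≤ 2 * Sf q e m + 2 * ((2 ^ Nat.log 4 m : ℕ) : ℝ) + C := by
      exact_mod_cast u2
    have hC0 : (0 : ℝ) ≤ C := by positivity
    constructor
    · nlinarith
    · linarith
  have hS : ∀ n : ℕ, 1 ≤ n → 2 * S q n ≤ n := by
    intro n hn
    have hg := (ville_G h1 h2 (fun _ => True) 0 (fun _ _ _ => trivial) n n (by
      simp only [Finset.filter_true, Finset.card_range]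
      exact (Nat.lt_pow_self (by norm_num)).le.trans
        (Nat.pow_le_pow_right (by norm_num) (Nat.le_succ n)))).1
    have : S q n = ((Finset.range n).filter (fun s => True ∧ q (s + 1) = true)).card := by
      rw [S_eq_Sf, Finset.card_filter]
      simp [Sf, bitVal]
    rw [this]
    simpa using hg
  refine ⟨q, ?_, hS, fun g hg => key g (Set.mem_insert_of_mem _ hg)⟩
  obtain ⟨C₁, C₂, -, hC2, hC⟩ := key _ (Set.mem_insert _ _) (fun k => k + 1)
    (fun a b h => by simpa using h) (by
      ext n
      simp only [Set.mem_range, Set.mem_ofPred_eq, and_true]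
      exact ⟨fun ⟨k, hk⟩ => by omega, fun h => ⟨n - 1, by omega⟩⟩)
  have h3 : 0 < Real.log 3 := Real.log_pos (by norm_num)
  have hα : Real.log 2 / Real.log 3 < 1 := by
    rw [div_lt_one h3]
    exact Real.log_lt_log (by norm_num) (by norm_num)
  have hlim : Tendsto (fun n : ℕ => (1 / 2 : ℝ) - C₂ * (n : ℝ) ^ (-(1 - Real.log 2 / Real.log 3)))
      atTop (nhds (1 / 2)) := by
    have := ((tendsto_rpow_neg_atTop (sub_pos.2 hα)).comp
      (tendsto_natCast_atTop_atTop (R := ℝ))).const_mul C₂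
    have := this.const_sub (1 / 2)
    simpa using this
  refine tendsto_of_tendsto_of_tendsto_of_le_of_le' hlim tendsto_const_nhds ?_ ?_
  · filter_upwards [eventually_ge_atTop 1] with n hn
    have hn' : (0 : ℝ) < n := by exact_mod_cast hn
    have := (hC n hn).1
    rw [← S_eq_Sf] at this
    rw [le_div_iff₀ hn']
    have hpw : (n : ℝ) ^ (-(1 - Real.log 2 / Real.log 3)) * n
        = (n : ℝ) ^ (Real.log 2 / Real.log 3) := by
      rw [← Real.rpow_add_one hn'.ne']
      congr 1
      ring
    rw [sub_mul, mul_assoc, hpw]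
    linarith
  · filter_upwards [eventually_ge_atTop 1] with n hn
    have hn' : (0 : ℝ) < n := by exact_mod_cast hn
    rw [div_le_iff₀ hn']
    have : (2 : ℝ) * S q n ≤ n := by exact_mod_cast hS n hn
    linarith
end

section
/- Ville's Theorem with arbitrarily small polynomial fluctuations: For every countable collection E of selection functions and every real number ε > 0 there exists a real q such that (1) lim_{n→∞} S_q(n)/n = 1/2, (2) for every n ≥ 1, 2·S_q(n) ≤ n, and (3) for every f ∈ E that selects an infinite subsequence of q there are constants C₁, C₂ ≥ 0 (depending on f and ε) such that for all m ≥ 1, m/2 − C₂·m^{ε} ≤ S_{f,q}(m) ≤ m/2 + C₁. -/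
open Filter

/-- The node of depth `k` visited with history `h`. -/
def nd (f : ℕ → List Bool → Bool) (h : List Bool) (k : ℕ) : List Bool :=
  (List.range k).map (fun j => f j h)

/-- Number of visits to `σ` before time `n`. -/
def cn (g : ℕ → List Bool) (n : ℕ) (σ : List Bool) : ℕ :=
  ((Finset.range n).filter (fun i => g i = σ)).card

/-- Depth of the node used in a given state. -/
noncomputable def dep (f : ℕ → List Bool → Bool) (K : ℕ) (s : List Bool × List (List Bool)) : ℕ :=
  sInf {k | s.2.count (nd f s.1 k) < K ^ k}

/-- Node used in a given state. -/
noncomputable def nodeOf (f : ℕ → List Bool → Bool) (K : ℕ) (s : List Bool × List (List Bool)) :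
    List Bool := nd f s.1 (dep f K s)

/-- Bit produced in a given state. -/
noncomputable def bitOf (f : ℕ → List Bool → Bool) (K : ℕ) (s : List Bool × List (List Bool)) :
    Bool := decide (s.2.count (nodeOf f K s) % 2 = 1)

/-- The sequence of states. -/
noncomputable def stt (f : ℕ → List Bool → Bool) (K : ℕ) : ℕ → List Bool × List (List Bool)
  | 0 => ([], [])
  | n + 1 => ((stt f K n).1 ++ [bitOf f K (stt f K n)], nodeOf f K (stt f K n) :: (stt f K n).2)

theorem cn_succ (g : ℕ → List Bool) (n : ℕ) (σ : List Bool) :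
    cn g (n + 1) σ = cn g n σ + if g n = σ then 1 else 0 := by
  unfold cn
  rw [Finset.range_add_one, Finset.filter_insert]
  split_ifs with h
  · rw [Finset.card_insert_of_notMem (by simp)]
  · rfl

theorem cn_mono (g : ℕ → List Bool) {n m : ℕ} (h : n ≤ m) (σ : List Bool) :
    cn g n σ ≤ cn g m σ := by
  unfold cn
  apply Finset.card_le_card
  intro i hi
  simp only [Finset.mem_filter, Finset.mem_range] at hi ⊢
  exact ⟨by omega, hi.2⟩

theorem nd_take (f : ℕ → List Bool → Bool) (h : List Bool) {k l : ℕ} (hkl : k ≤ l) :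
    (nd f h l).take k = nd f h k := by
  unfold nd
  rw [← List.map_take, List.take_range, min_eq_left hkl]

theorem nd_length (f : ℕ → List Bool → Bool) (h : List Bool) (k : ℕ) :
    (nd f h k).length = k := by simp [nd]

theorem exists_construction (f : ℕ → List Bool → Bool) (K : ℕ) (hK : 2 ≤ K) :
    ∃ (q : ℕ → Bool) (g : ℕ → List Bool), ∀ i,
      g i = nd f (initSeg q (i + 1)) (g i).length ∧
      cn g i (g i) < K ^ (g i).length ∧
      (∀ k < (g i).length, K ^ k ≤ cn g i ((g i).take k)) ∧
      bitVal (q (i + 1)) = cn g i (g i) % 2 := by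
  let g : ℕ → List Bool := fun i => nodeOf f K (stt f K i)
  let q : ℕ → Bool := fun i => bitOf f K (stt f K (i - 1))
  have hcount : ∀ n σ, (stt f K n).2.count σ = cn g n σ := by
    intro n σ
    induction n with
    | zero => simp [stt, cn]
    | succ n ih =>
      rw [cn_succ, ← ih]
      simp only [stt, List.count_cons, g, beq_iff_eq]
  have hhist : ∀ n, (stt f K n).1 = initSeg q (n + 1) := by
    intro n
    induction n with
    | zero => simp [stt, initSeg]
    | succ n ih =>
      simp only [stt, ih, initSeg, Nat.add_sub_cancel, List.range_succ, List.map_append,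
        List.map_cons, List.map_nil, q]
  refine ⟨q, g, fun i => ?_⟩
  have hne : {k | (stt f K i).2.count (nd f (stt f K i).1 k) < K ^ k}.Nonempty := by
    refine ⟨i, ?_⟩
    simp only [Set.mem_ofPred_eq, hcount]
    calc cn g i _ ≤ i := by
          unfold cn
          exact (Finset.card_filter_le _ _).trans (by simp)
      _ < K ^ i := Nat.lt_pow_self (by omega)
  have hlen : (g i).length = dep f K (stt f K i) := nd_length _ _ _
  have hg : g i = nd f (stt f K i).1 (dep f K (stt f K i)) := rfl
  refine ⟨?_, ?_, ?_, ?_⟩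
  · rw [hlen, ← hhist]
    exact hg
  · have := Nat.sInf_mem hne
    rw [hlen, ← hcount]
    exact this
  · intro k hk
    rw [hlen] at hk
    have := Nat.notMem_of_lt_sInf hk
    simp only [Set.mem_ofPred_eq, not_lt, hcount] at this
    rw [hg, nd_take _ _ hk.le]
    exact this
  · rw [← hcount]
    simp only [q, Nat.add_sub_cancel, bitOf, bitVal, g]
    rcases Nat.mod_two_eq_zero_or_one ((stt f K i).2.count (nodeOf f K (stt f K i))) with h | h <;>
      simp [h]

theorem node_sum (g : ℕ → List Bool) (b : ℕ → ℕ) (hb : ∀ i, b i = cn g i (g i) % 2)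
    (n : ℕ) (σ : List Bool) :
    ∑ i ∈ (Finset.range n).filter (fun i => g i = σ), (1 - 2 * (b i : ℤ)) = (cn g n σ % 2 : ℕ) := by
  induction n with
  | zero => simp [cn]
  | succ n ih =>
    rw [Finset.range_add_one, Finset.filter_insert, cn_succ]
    split_ifs with h
    · rw [Finset.sum_insert (by simp), ih, hb, h]
      push_cast
      omega
    · simpa using ih

theorem fact_A (g : ℕ → List Bool) (b : ℕ → ℕ) (hb : ∀ i, b i = cn g i (g i) % 2)
    (P : List Bool → Prop) [DecidablePred P] (n : ℕ) :
    0 ≤ ∑ i ∈ (Finset.range n).filter (fun i => P (g i)), (1 - 2 * (b i : ℤ)) ∧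
    ∑ i ∈ (Finset.range n).filter (fun i => P (g i)), (1 - 2 * (b i : ℤ)) ≤
      (((Finset.range n).filter (fun i => P (g i))).image g).card := by
  have key : ∑ i ∈ (Finset.range n).filter (fun i => P (g i)), (1 - 2 * (b i : ℤ)) =
      ∑ σ ∈ ((Finset.range n).filter (fun i => P (g i))).image g, ((cn g n σ % 2 : ℕ) : ℤ) := by
    rw [← Finset.sum_fiberwise_of_maps_to (g := g)
      (t := ((Finset.range n).filter (fun i => P (g i))).image g)
      (fun i hi => Finset.mem_image_of_mem g hi)]
    apply Finset.sum_congr rfl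
    intro σ hσ
    rw [← node_sum g b hb]
    apply Finset.sum_congr _ (fun _ _ => rfl)
    rw [Finset.filter_filter]
    apply Finset.filter_congr
    intro i _
    obtain ⟨i', hi', rfl⟩ := Finset.mem_image.1 hσ
    have := (Finset.mem_filter.1 hi').2
    constructor
    · exact fun h => h.2
    · exact fun h => ⟨h ▸ this, h⟩
  rw [key]
  constructor
  · exact Finset.sum_nonneg (fun _ _ => by positivity)
  · calc _ ≤ ∑ σ ∈ ((Finset.range n).filter (fun i => P (g i))).image g, (1 : ℤ) := by
          apply Finset.sum_le_sum
          intro σ _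
          omega
      _ = _ := by simp

/-- Lists of length at most `k`. -/
def shortLists : ℕ → Finset (List Bool)
  | 0 => {[]}
  | k + 1 => insert [] ((shortLists k).image (List.cons true) ∪ (shortLists k).image (List.cons false))

theorem mem_shortLists (k : ℕ) (l : List Bool) (h : l.length ≤ k) : l ∈ shortLists k := by
  induction k generalizing l with
  | zero => simp at h; simp [shortLists, h]
  | succ k ih =>
    cases l with
    | nil => simp [shortLists]
    | cons a l =>
      have := ih l (by simpa using h)
      cases a <;> simp [shortLists, this]

theorem card_shortLists (k : ℕ) : (shortLists k).card + 1 ≤ 2 ^ (k + 1) := by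
  induction k with
  | zero => simp [shortLists]
  | succ k ih =>
    have h1 := Finset.card_insert_le ([] : List Bool)
      ((shortLists k).image (List.cons true) ∪ (shortLists k).image (List.cons false))
    have h2 := Finset.card_union_le ((shortLists k).image (List.cons true))
      ((shortLists k).image (List.cons false))
    have h3 := Finset.card_image_le (s := shortLists k) (f := List.cons true)
    have h4 := Finset.card_image_le (s := shortLists k) (f := List.cons false)
    rw [pow_succ]
    simp only [shortLists]
    omega

theorem main_bound (f : ℕ → List Bool → Bool) (K : ℕ) (hK : 2 ≤ K) (δ : ℝ) (hδ : 0 < δ)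
    (hKδ : 2 ≤ (K : ℝ) ^ δ) (q : ℕ → Bool) (g : ℕ → List Bool)
    (hq : ∀ i, g i = nd f (initSeg q (i + 1)) (g i).length ∧
      cn g i (g i) < K ^ (g i).length ∧
      (∀ k < (g i).length, K ^ k ≤ cn g i ((g i).take k)) ∧
      bitVal (q (i + 1)) = cn g i (g i) % 2) (j : ℕ) :
    ∃ C : ℝ, 0 ≤ C ∧ ∀ n m s : ℕ,
      ((Finset.range n).filter (fun i => f j (initSeg q (i + 1)) = true)).card = m →
      ∑ i ∈ (Finset.range n).filter (fun i => f j (initSeg q (i + 1)) = true),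
        bitVal (q (i + 1)) = s → 1 ≤ m →
      (m : ℝ) / 2 - C * (m : ℝ) ^ δ ≤ s ∧ (s : ℝ) ≤ m / 2 + C := by
  let c : ℕ := K ^ j * (shortLists j).card
  refine ⟨c + 2 ^ (j + 2) + 4, by positivity, ?_⟩
  intro n m s hm hs hm1
  set T := (Finset.range n).filter (fun i => f j (initSeg q (i + 1)) = true) with hT
  let P : List Bool → Prop := fun σ => σ[j]? = some true
  have hPlen : ∀ σ, P σ → j < σ.length := by
    intro σ h
    exact (List.getElem?_eq_some_iff.1 h).1
  have hPi : ∀ i, P (g i) ↔ f j (initSeg q (i + 1)) = true ∧ j < (g i).length := by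
    intro i
    constructor
    · intro h
      have hl := hPlen _ h
      refine ⟨?_, hl⟩
      simp only [P] at h
      rw [(hq i).1] at h
      simpa [nd, List.getElem?_range, hl] using h
    · rintro ⟨h, hl⟩
      simp only [P]
      rw [(hq i).1]
      simp [nd, List.getElem?_range, hl, h]
  classical
  set TP := (Finset.range n).filter (fun i => P (g i)) with hTP
  set TS := T.filter (fun i => ¬ j < (g i).length) with hTS
  have hTP' : T.filter (fun i => j < (g i).length) = TP := by
    rw [hT, Finset.filter_filter, hTP]
    exact Finset.filter_congr (fun i _ => (hPi i).symm)
  have hTPsub : TP ⊆ T := by rw [← hTP']; exact Finset.filter_subset _ _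
  have hcn : ∀ n σ, cn g n σ ≤ K ^ σ.length := by
    intro n σ
    induction n with
    | zero => simp [cn]
    | succ n ih =>
      rw [cn_succ]
      split_ifs with h
      · have := (hq n).2.1
        rw [h] at this
        omega
      · omega
  have hTScard : TS.card ≤ c := by
    apply Finset.card_le_mul_card_image_of_maps_to (f := g) (t := shortLists j)
    · intro i hi
      apply mem_shortLists
      have := (Finset.mem_filter.1 hi).2
      omega
    · intro σ hσ
      by_cases hl : σ.length ≤ j
      · calc _ ≤ cn g n σ := by
              unfold cn
              apply Finset.card_le_card
              intro i hi
              simp only [hTS, hT, Finset.mem_filter] at hi ⊢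
              exact ⟨hi.1.1.1, hi.2⟩
          _ ≤ K ^ σ.length := hcn n σ
          _ ≤ K ^ j := Nat.pow_le_pow_right (by omega) hl
      · rw [Finset.card_eq_zero.2]
        · positivity
        · ext i
          simp only [hTS, Finset.mem_filter, Finset.notMem_empty, iff_false]
          rintro ⟨⟨_, h1⟩, rfl⟩
          omega
  have hA := fact_A g (fun i => bitVal (q (i + 1))) (fun i => (hq i).2.2.2) P n
  rw [← hTP] at hA
  have hsplit : (m : ℤ) - 2 * s = ∑ i ∈ TP, (1 - 2 * (bitVal (q (i + 1)) : ℤ)) +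
      ∑ i ∈ TS, (1 - 2 * (bitVal (q (i + 1)) : ℤ)) := by
    rw [← hTP', hTS, Finset.sum_filter_add_sum_filter_not, Finset.sum_sub_distrib,
      ← Finset.mul_sum, ← hm, ← hs]
    simp
  have hbit : ∀ b, |1 - 2 * (bitVal b : ℤ)| ≤ 1 := by
    intro b; cases b <;> simp [bitVal]
  have hTSsum : |∑ i ∈ TS, (1 - 2 * (bitVal (q (i + 1)) : ℤ))| ≤ c := by
    calc _ ≤ ∑ i ∈ TS, |1 - 2 * (bitVal (q (i + 1)) : ℤ)| := Finset.abs_sum_le_sum_abs _ _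
      _ ≤ ∑ i ∈ TS, 1 := Finset.sum_le_sum (fun i _ => hbit _)
      _ ≤ c := by simpa using hTScard
  have hmδ : (1 : ℝ) ≤ (m : ℝ) ^ δ := Real.one_le_rpow (by exact_mod_cast hm1) hδ.le
  have hd : ((TP.image g).card : ℝ) ≤ 2 ^ (j + 2) + 4 * (m : ℝ) ^ δ := by
    rcases (TP.image g).eq_empty_or_nonempty with h0 | hne
    · rw [h0]; simp; positivity
    obtain ⟨σ, hσ, hmax⟩ := Finset.exists_max_image (TP.image g) List.length hne
    have hcard : (TP.image g).card ≤ 2 ^ (σ.length + 1) := by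
      have h1 : (TP.image g).card ≤ (shortLists σ.length).card :=
        Finset.card_le_card (fun τ hτ => mem_shortLists _ _ (hmax τ hτ))
      have := card_shortLists σ.length
      omega
    have hcard' : ((TP.image g).card : ℝ) ≤ 2 ^ (σ.length + 1) := by exact_mod_cast hcard
    by_cases hl : σ.length ≤ j + 1
    · have : (2 : ℝ) ^ (σ.length + 1) ≤ 2 ^ (j + 2) :=
        pow_le_pow_right₀ (by norm_num) (by omega)
      linarith
    · obtain ⟨i, hi, rfl⟩ := Finset.mem_image.1 hσ
      obtain ⟨k, hk⟩ : ∃ k, (g i).length = k + 1 := ⟨(g i).length - 1, by omega⟩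
      have hin : i < n := by simpa using (Finset.mem_filter.1 hi).1
      have hPg : P (g i) := (Finset.mem_filter.1 hi).2
      have hPt : P ((g i).take k) := by
        simp only [P] at hPg ⊢
        rw [List.getElem?_take_of_lt (by omega)]
        exact hPg
      have h1 : K ^ k ≤ m := by
        calc K ^ k ≤ cn g i ((g i).take k) := (hq i).2.2.1 k (by omega)
          _ ≤ cn g n ((g i).take k) := cn_mono g hin.le _
          _ ≤ TP.card := by
              apply Finset.card_le_card
              intro t ht
              simp only [hTP, Finset.mem_filter] at ht ⊢
              exact ⟨ht.1, by rw [ht.2]; exact hPt⟩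
          _ ≤ m := by rw [← hm]; exact Finset.card_le_card hTPsub
      have h2 : (2 : ℝ) ^ k ≤ (m : ℝ) ^ δ := by
        calc (2 : ℝ) ^ k ≤ ((K : ℝ) ^ δ) ^ k := pow_le_pow_left₀ (by norm_num) hKδ k
          _ = ((K : ℝ) ^ k) ^ δ := by
              rw [← Real.rpow_natCast, ← Real.rpow_natCast, ← Real.rpow_mul (by positivity),
                ← Real.rpow_mul (by positivity), mul_comm]
          _ ≤ (m : ℝ) ^ δ := Real.rpow_le_rpow (by positivity) (by exact_mod_cast h1) hδ.le
      rw [hk, pow_add, pow_add] at hcard'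
      have : (0 : ℝ) ≤ 2 ^ (j + 2) := by positivity
      linarith
  obtain ⟨hA1, hA2⟩ := hA
  rw [abs_le] at hTSsum
  have e1 : (m : ℤ) - 2 * s ≤ (TP.image g).card + c := by rw [hsplit]; linarith [hTSsum.2]
  have e2 : -(c : ℤ) ≤ (m : ℤ) - 2 * s := by rw [hsplit]; linarith [hTSsum.1]
  have e1' : (m : ℝ) - 2 * s ≤ (TP.image g).card + c := by exact_mod_cast e1
  have e2' : -(c : ℝ) ≤ (m : ℝ) - 2 * s := by exact_mod_cast e2
  have hc0 : (0 : ℝ) ≤ c := Nat.cast_nonneg c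
  have hp0 : (0 : ℝ) ≤ 2 ^ (j + 2) := by positivity
  constructor
  · nlinarith
  · linarith

theorem S_eq (q : ℕ → Bool) (n : ℕ) : S q n = ∑ i ∈ Finset.range n, bitVal (q (i + 1)) := by
  unfold S
  rw [Finset.range_eq_Ico, Finset.sum_Ico_add' (fun i => bitVal (q i)) 0 n 1]
  rfl

/-- **Ville's Theorem with arbitrarily small polynomial fluctuations.** -/
theorem ville_theorem_small_polynomial (E : Set (List Bool → Bool)) (hE : E.Countable)
    (ε : ℝ) (hε : 0 < ε) :
    ∃ q : ℕ → Bool,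
      Tendsto (fun n => (S q n : ℝ) / n) atTop (nhds (1 / 2)) ∧
      (∀ n : ℕ, 1 ≤ n → 2 * S q n ≤ n) ∧
      (∀ f ∈ E, ∀ e : ℕ → ℕ, StrictMono e →
        Set.range e = {n | 1 ≤ n ∧ f (initSeg q n) = true} →
        ∃ C₁ C₂ : ℝ, 0 ≤ C₁ ∧ 0 ≤ C₂ ∧ ∀ m : ℕ, 1 ≤ m →
          (m : ℝ) / 2 - C₂ * (m : ℝ) ^ ε ≤ (Sf q e m : ℝ) ∧
          (Sf q e m : ℝ) ≤ m / 2 + C₁) := by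
  obtain ⟨F, hF⟩ := (hE.insert (fun _ => true)).exists_eq_range (Set.insert_nonempty _ _)
  set δ : ℝ := min ε (1 / 2) with hδdef
  have hδ : 0 < δ := lt_min hε (by norm_num)
  have hδ1 : δ ≤ 1 / 2 := min_le_right _ _
  obtain ⟨K, hK, hKδ⟩ : ∃ K : ℕ, 2 ≤ K ∧ 2 ≤ (K : ℝ) ^ δ := by
    have h := ((tendsto_rpow_atTop hδ).comp (tendsto_natCast_atTop_atTop (R := ℝ))).eventually_ge_atTop 2
    obtain ⟨K, h1, h2⟩ := (h.and (eventually_ge_atTop 2)).exists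
    exact ⟨K, h2, h1⟩
  obtain ⟨q, g, hq⟩ := exists_construction F K hK
  have hmain := main_bound F K hK δ hδ hKδ q g hq
  have hhalf : ∀ n : ℕ, 2 * S q n ≤ n := by
    intro n
    have hA := (fact_A g (fun i => bitVal (q (i + 1))) (fun i => (hq i).2.2.2)
      (fun _ => True) n).1
    simp only [Finset.filter_true, Finset.sum_sub_distrib, ← Finset.mul_sum] at hA
    rw [S_eq]
    simp only [Finset.sum_const, Finset.card_range, nsmul_eq_mul, mul_one] at hA
    zify
    linarith
  refine ⟨q, ?_, fun n _ => hhalf n, ?_⟩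
  · obtain ⟨j, hj⟩ : (fun _ => true) ∈ Set.range F := hF ▸ Set.mem_insert _ _
    obtain ⟨C, hC0, hC⟩ := hmain j
    have hlow : ∀ n : ℕ, 1 ≤ n → 1 / 2 - C * (n : ℝ) ^ (-(1 / 2 : ℝ)) ≤ (S q n : ℝ) / n := by
      intro n hn
      have h := (hC n n (S q n) (by simp [hj]) (by simp [hj, S_eq]) hn).1
      have hn0 : (0 : ℝ) < n := by exact_mod_cast hn
      have hn1 : (1 : ℝ) ≤ n := by exact_mod_cast hn
      rw [le_div_iff₀ hn0, sub_mul, mul_assoc]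
      have h3 : (n : ℝ) ^ (-(1 / 2 : ℝ)) * n = (n : ℝ) ^ (1 / 2 : ℝ) := by
        rw [← Real.rpow_add_one hn0.ne']
        norm_num
      rw [h3]
      have h4 : (n : ℝ) ^ δ ≤ (n : ℝ) ^ (1 / 2 : ℝ) := Real.rpow_le_rpow_of_exponent_le hn1 hδ1
      have := mul_le_mul_of_nonneg_left h4 hC0
      linarith
    have hlim : Tendsto (fun n : ℕ => 1 / 2 - C * (n : ℝ) ^ (-(1 / 2 : ℝ))) atTop (nhds (1 / 2)) := by
      have h := ((tendsto_rpow_neg_atTop (show (0 : ℝ) < 1 / 2 by norm_num)).comp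
        (tendsto_natCast_atTop_atTop (R := ℝ)))
      have := (h.const_mul C).const_sub (1 / 2)
      simpa using this
    refine tendsto_of_tendsto_of_tendsto_of_le_of_le' hlim tendsto_const_nhds ?_ ?_
    · filter_upwards [eventually_ge_atTop 1] with n hn using hlow n hn
    · filter_upwards [eventually_ge_atTop 1] with n hn
      have hn0 : (0 : ℝ) < n := by exact_mod_cast hn
      rw [div_le_iff₀ hn0]
      have : (2 : ℝ) * S q n ≤ n := by exact_mod_cast hhalf n
      linarith
  · intro f hf e he hrange
    obtain ⟨j, rfl⟩ : f ∈ Set.range F := hF ▸ Set.mem_insert_of_mem _ hf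
    obtain ⟨C, hC0, hC⟩ := hmain j
    refine ⟨C, C, hC0, hC0, fun m hm => ?_⟩
    have hsel : ∀ k, 1 ≤ e k ∧ F j (initSeg q (e k)) = true := by
      intro k
      have : e k ∈ Set.range e := ⟨k, rfl⟩
      rw [hrange] at this
      exact this
    have himg : (Finset.range (e m - 1)).filter (fun i => F j (initSeg q (i + 1)) = true) =
        (Finset.range m).image (fun k => e k - 1) := by
      ext i
      simp only [Finset.mem_filter, Finset.mem_range, Finset.mem_image]
      constructor
      · rintro ⟨h1, h2⟩
        have : i + 1 ∈ Set.range e := by rw [hrange]; exact ⟨by omega, h2⟩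
        obtain ⟨k, hk⟩ := this
        refine ⟨k, ?_, by omega⟩
        apply he.lt_iff_lt.1
        omega
      · rintro ⟨k, hk, rfl⟩
        have h1 := hsel k
        have h2 := he hk
        refine ⟨by omega, ?_⟩
        rw [Nat.sub_add_cancel h1.1]
        exact h1.2
    have hinj : Set.InjOn (fun k => e k - 1) (Finset.range m : Set ℕ) := by
      intro a _ b _ hab
      apply he.injective
      have h1 := (hsel a).1
      have h2 := (hsel b).1
      simp only at hab
      omega
    have h := hC (e m - 1) m (Sf q e m)
      (by rw [himg, Finset.card_image_of_injOn hinj, Finset.card_range])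
      (by
        rw [himg, Finset.sum_image hinj]
        unfold Sf
        apply Finset.sum_congr rfl
        intro k _
        rw [Nat.sub_add_cancel (hsel k).1]) hm
    refine ⟨?_, h.2⟩
    have h4 : (m : ℝ) ^ δ ≤ (m : ℝ) ^ ε :=
      Real.rpow_le_rpow_of_exponent_le (by exact_mod_cast hm) (min_le_left _ _)
    have := mul_le_mul_of_nonneg_left h4 hC0
    linarith [h.1]
end

section
/- Finite version of Ville's Theorem: For every finite collection E of selection functions there exists a real q such that: (1) lim_{n→∞} S_q(n)/n = 1/2; (2) for every f ∈ E that selects an infinite subsequence of q, lim_{m→∞} S_{f,q}(m)/m = 1/2; and (3) for every n ≥ 1, 2·S_q(n) ≤ n. -/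
open Filter

open Classical in
noncomputable def villeNext {P : Type*} (p : List Bool → P) (w : List Bool) : Bool :=
  decide (Odd (((Finset.Ico 1 (w.length + 1)).filter (fun k => p (w.take (k - 1)) = p w)).card))

noncomputable def villeW {P : Type*} (p : List Bool → P) : ℕ → List Bool
  | 0 => []
  | n + 1 => villeW p n ++ [villeNext p (villeW p n)]

noncomputable def villeQ {P : Type*} (p : List Bool → P) (n : ℕ) : Bool :=
  villeNext p (villeW p (n - 1))

lemma villeW_eq {P : Type*} (p : List Bool → P) (n : ℕ) :
    villeW p n = (List.range n).map (fun i => villeQ p (i + 1)) := by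
  induction n with
  | zero => rfl
  | succ n ih =>
    rw [List.range_succ, List.map_append, ← ih]
    simp [villeW, villeQ]

lemma initSeg_villeQ {P : Type*} (p : List Bool → P) (n : ℕ) :
    initSeg (villeQ p) n = villeW p (n - 1) := by
  rw [villeW_eq]; rfl

open Classical in
lemma villeQ_spec {P : Type*} (p : List Bool → P) (n : ℕ) (hn : 1 ≤ n) :
    villeQ p n = decide (Odd (((Finset.Ico 1 n).filter
      (fun k => p (initSeg (villeQ p) k) = p (initSeg (villeQ p) n))).card)) := by
  have hl : (villeW p (n - 1)).length + 1 = n := by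
    rw [villeW_eq]; simp; omega
  have : (Finset.Ico 1 n).filter
      (fun k => p (initSeg (villeQ p) k) = p (initSeg (villeQ p) n)) =
      (Finset.Ico 1 n).filter
      (fun k => p ((villeW p (n - 1)).take (k - 1)) = p (villeW p (n - 1))) := by
    apply Finset.filter_congr
    intro k hk
    rw [Finset.mem_Ico] at hk
    have : (villeW p (n - 1)).take (k - 1) = villeW p (k - 1) := by
      rw [villeW_eq, villeW_eq, ← List.map_take, List.take_range, min_eq_left (by omega)]
    rw [this, initSeg_villeQ, initSeg_villeQ]
  rw [this]
  conv_lhs => rw [villeQ, villeNext, hl]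

open Classical in
lemma ville_class {P : Type*} (c : ℕ → P) (q : ℕ → Bool)
    (h : ∀ n, 1 ≤ n → q n = decide (Odd (((Finset.Ico 1 n).filter (fun k => c k = c n)).card)))
    (A : P) (N : ℕ) :
    ∑ i ∈ (Finset.Ico 1 N).filter (fun k => c k = A), bitVal (q i) =
      ((Finset.Ico 1 N).filter (fun k => c k = A)).card / 2 := by
  induction N with
  | zero => simp
  | succ n ih =>
    rcases Nat.eq_zero_or_pos n with rfl | hn
    · simp
    rw [← Finset.insert_Ico_right_eq_Ico_add_one hn, Finset.filter_insert]
    split_ifs with hA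
    · rw [Finset.sum_insert (by simp), Finset.card_insert_of_notMem (by simp), ih, h n hn, hA]
      unfold bitVal
      by_cases ho : Odd ((Finset.Ico 1 n).filter (fun k => c k = A)).card
      · simp only [ho, decide_true, if_true]
        obtain ⟨r, hr⟩ := ho
        omega
      · simp only [ho, decide_false]
        obtain ⟨r, hr⟩ := Nat.not_odd_iff_even.mp ho
        simp
        omega
    · exact ih

open Classical in
lemma ville_bound {P : Type*} [Fintype P] (c : ℕ → P) (q : ℕ → Bool)
    (h : ∀ n, 1 ≤ n → q n = decide (Odd (((Finset.Ico 1 n).filter (fun k => c k = c n)).card)))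
    (T : P → Prop) [DecidablePred T] (N : ℕ) :
    2 * ∑ i ∈ (Finset.Ico 1 N).filter (fun k => T (c k)), bitVal (q i) ≤
      ((Finset.Ico 1 N).filter (fun k => T (c k))).card ∧
    ((Finset.Ico 1 N).filter (fun k => T (c k))).card ≤
    2 * ∑ i ∈ (Finset.Ico 1 N).filter (fun k => T (c k)), bitVal (q i) + Fintype.card P := by
  have hm : ∀ i ∈ (Finset.Ico 1 N).filter (fun k => T (c k)),
      c i ∈ Finset.univ.filter T := by
    intro i hi; simpa using (Finset.mem_filter.mp hi).2
  have e : ∀ A ∈ Finset.univ.filter T, ((Finset.Ico 1 N).filter (fun k => T (c k))).filter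
      (fun k => c k = A) = (Finset.Ico 1 N).filter (fun k => c k = A) := by
    intro A hA
    have hA : T A := by simpa using hA
    ext k
    simp only [Finset.mem_filter]
    constructor
    · rintro ⟨⟨a, _⟩, b⟩; exact ⟨a, b⟩
    · rintro ⟨a, b⟩; exact ⟨⟨a, b ▸ hA⟩, b⟩
  have h1 := Finset.card_eq_sum_card_fiberwise hm
  have h2 := Finset.sum_fiberwise_of_maps_to hm (fun i => bitVal (q i))
  have h3 : ∑ i ∈ (Finset.Ico 1 N).filter (fun k => T (c k)), bitVal (q i) =
      ∑ A ∈ Finset.univ.filter T, ((Finset.Ico 1 N).filter (fun k => c k = A)).card / 2 := by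
    rw [← h2]
    apply Finset.sum_congr rfl
    intro A hA
    rw [e A hA, ville_class c q h]
  have h4 : ((Finset.Ico 1 N).filter (fun k => T (c k))).card =
      ∑ A ∈ Finset.univ.filter T, ((Finset.Ico 1 N).filter (fun k => c k = A)).card := by
    rw [h1]
    apply Finset.sum_congr rfl
    intro A hA
    rw [e A hA]
  rw [h3, h4, Finset.mul_sum]
  constructor
  · apply Finset.sum_le_sum
    intro A _
    omega
  · have h5 : (Finset.univ.filter T).card ≤ Fintype.card P := Finset.card_le_univ _
    refine le_trans ?_ (Nat.add_le_add_left h5 _)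
    rw [Finset.card_eq_sum_ones, ← Finset.sum_add_distrib]
    apply Finset.sum_le_sum
    intro A _
    omega

lemma ville_tendsto (s : ℕ → ℕ) (C : ℕ) (h1 : ∀ n, 2 * s n ≤ n) (h2 : ∀ n, n ≤ 2 * s n + C) :
    Tendsto (fun n => (s n : ℝ) / n) atTop (nhds (1 / 2)) := by
  have hl : Tendsto (fun n : ℕ => (1 / 2 : ℝ) - (C / 2 : ℝ) / n) atTop (nhds (1 / 2)) := by
    simpa using (tendsto_const_nhds (x := (1 / 2 : ℝ))).sub
      (tendsto_const_div_atTop_nhds_zero_nat (C / 2 : ℝ))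
  refine tendsto_of_tendsto_of_tendsto_of_le_of_le' hl tendsto_const_nhds ?_ ?_
  · filter_upwards [eventually_gt_atTop 0] with n hn
    have hn' : (0 : ℝ) < n := by exact_mod_cast hn
    have := h2 n
    have h : (n : ℝ) ≤ 2 * s n + C := by exact_mod_cast this
    rw [sub_le_iff_le_add, ← add_div, le_div_iff₀ hn']
    linarith
  · filter_upwards [eventually_gt_atTop 0] with n hn
    have hn' : (0 : ℝ) < n := by exact_mod_cast hn
    have h : 2 * (s n : ℝ) ≤ n := by exact_mod_cast h1 n
    rw [div_le_iff₀ hn']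
    linarith

/-- **Finite version of Ville's Theorem.** -/
theorem ville_theorem_finite (E : Set (List Bool → Bool)) (hE : E.Finite) :
    ∃ q : ℕ → Bool,
      Tendsto (fun n => (S q n : ℝ) / n) atTop (nhds (1 / 2)) ∧
      (∀ f ∈ E, ∀ e : ℕ → ℕ, StrictMono e →
        Set.range e = {n | 1 ≤ n ∧ f (initSeg q n) = true} →
        Tendsto (fun m => (Sf q e m : ℝ) / m) atTop (nhds (1 / 2))) ∧
      (∀ n : ℕ, 1 ≤ n → 2 * S q n ≤ n) := by
  classical
  have : Fintype E := hE.fintype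
  let p : List Bool → (E → Bool) := fun w f => f.1 w
  let q := villeQ p
  have hb := fun (T : (E → Bool) → Prop) [DecidablePred T] (N : ℕ) =>
    ville_bound (fun n => p (initSeg q n)) q (fun n hn => villeQ_spec p n hn) T N
  have hS : ∀ n, 2 * S q n ≤ n ∧ n ≤ 2 * S q n + Fintype.card (E → Bool) := by
    intro n
    have := hb (fun _ => True) (n + 1)
    have hI : Finset.Ico 1 (n + 1) = Finset.Icc 1 n := by ext; simp
    simp only [Finset.filter_true, hI, Nat.card_Icc, Nat.add_sub_cancel] at this
    exact this
  refine ⟨q, ville_tendsto _ _ (fun n => (hS n).1) (fun n => (hS n).2), ?_, fun n _ => (hS n).1⟩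
  intro f hf e he hr
  have hSf : ∀ m, 2 * Sf q e m ≤ m ∧ m ≤ 2 * Sf q e m + Fintype.card (E → Bool) := by
    intro m
    have := hb (fun A => A ⟨f, hf⟩ = true) (e m)
    have hI : (Finset.Ico 1 (e m)).filter (fun k => p (initSeg q k) ⟨f, hf⟩ = true) =
        (Finset.range m).image e := by
      ext k
      have hk : k ∈ Set.range e ↔ 1 ≤ k ∧ f (initSeg q k) = true := by rw [hr]; rfl
      simp only [Finset.mem_filter, Finset.mem_Ico, Finset.mem_image, Finset.mem_range]
      constructor
      · rintro ⟨⟨a, b⟩, d⟩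
        obtain ⟨j, rfl⟩ := hk.2 ⟨a, d⟩
        exact ⟨j, he.lt_iff_lt.1 b, rfl⟩
      · rintro ⟨j, hj, rfl⟩
        have := hk.1 ⟨j, rfl⟩
        exact ⟨⟨this.1, he hj⟩, this.2⟩
    rw [hI, Finset.card_image_of_injective _ he.injective,
      Finset.sum_image (fun _ _ _ _ hh => he.injective hh), Finset.card_range] at this
    exact this
  exact ville_tendsto _ _ (fun n => (hSf n).1) (fun n => (hSf n).2)
end

section
/- Strengthened finite version of Ville's Theorem: Let E be a finite collection of selection functions that contains the always-care selection function h (h(σ) = care for every finite binary sequence σ). Then there exists a real q such that for every f ∈ E that selects an infinite subsequence of q and every m ≥ 1, 0 ≤ m/2 − S_{f,q}(m) ≤ 2^{card(E)}. (In particular, taking f = h, every initial segment of q has at least as many 0's as 1's, with deficit at most 2^{card(E)}.) -/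
open Filter

open Classical in
/-- State: prefix built so far, and for each class the parity (next bit). -/
noncomputable def vState (E : Finset (List Bool → Bool)) :
    ℕ → List Bool × (Finset (List Bool → Bool) → Bool)
  | 0 => ([], fun _ => false)
  | n + 1 =>
    let s := vState E n
    let c := E.filter (fun f => f s.1 = true)
    (s.1 ++ [s.2 c], Function.update s.2 c (!(s.2 c)))

/-- The class of functions caring at stage `n`. -/
noncomputable def vCls (E : Finset (List Bool → Bool)) (n : ℕ) : Finset (List Bool → Bool) :=
  E.filter (fun f => f (vState E n).1 = true)

/-- The constructed real. -/
noncomputable def vReal (E : Finset (List Bool → Bool)) (n : ℕ) : Bool :=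
  (vState E (n - 1)).2 (vCls E (n - 1))

lemma vInit (E : Finset (List Bool → Bool)) (n : ℕ) :
    initSeg (vReal E) (n + 1) = (vState E n).1 := by
  induction n with
  | zero => simp [initSeg, vState]
  | succ n ih =>
    simp only [initSeg, Nat.add_sub_cancel] at ih ⊢
    rw [List.range_succ, List.map_append, ih]
    simp [vState, vReal, vCls]

open Classical in
lemma vSum (E : Finset (List Bool → Bool)) (f : List Bool → Bool) (hf : f ∈ E) (N : ℕ) :
    ∑ i ∈ (Finset.range N).filter (fun i => f (vState E i).1 = true),
      (1 - 2 * (bitVal (vReal E (i + 1)) : ℤ)) =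
    ∑ A ∈ E.powerset.filter (fun A => f ∈ A), (bitVal ((vState E N).2 A) : ℤ) := by
  induction N with
  | zero => simp [vState, bitVal]
  | succ N ih =>
    have key : ∀ A, (bitVal ((vState E (N + 1)).2 A) : ℤ) =
        (bitVal ((vState E N).2 A) : ℤ) +
          if A = vCls E N then (1 - 2 * (bitVal (vReal E (N + 1)) : ℤ)) else 0 := by
      intro A
      have h1 : (vState E (N + 1)).2 =
        Function.update (vState E N).2 (vCls E N) (!((vState E N).2 (vCls E N))) := by
        simp only [vState, vCls]
      rw [h1]
      by_cases h : A = vCls E N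
      · subst h
        simp only [Function.update_self, vReal, Nat.add_sub_cancel, if_true]
        cases (vState E N).2 (vCls E N) <;> simp [bitVal]
      · simp [h]
    rw [Finset.sum_congr rfl (fun A _ => key A), Finset.sum_add_distrib, ← ih,
      Finset.sum_ite_eq', Finset.range_add_one, Finset.filter_insert]
    have hm : vCls E N ∈ E.powerset.filter (fun A => f ∈ A) ↔ f (vState E N).1 = true := by
      simp [vCls, hf]
    by_cases h : f (vState E N).1 = true
    · rw [if_pos h, if_pos (hm.2 h), Finset.sum_insert (by simp), add_comm]
    · rw [if_neg h, if_neg (fun h' => h (hm.1 h')), add_zero]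

lemma vBound (E : Finset (List Bool → Bool)) (f : List Bool → Bool) (e : ℕ → ℕ)
    (hf : f ∈ E) (he : StrictMono e)
    (hr : Set.range e = {n | 1 ≤ n ∧ f (initSeg (vReal E) n) = true}) (m : ℕ) :
    0 ≤ (m : ℤ) - 2 * (Sf (vReal E) e m : ℤ) ∧
    (m : ℤ) - 2 * (Sf (vReal E) e m : ℤ) ≤ 2 ^ E.card := by
  classical
  have hmem : ∀ k, 1 ≤ e k ∧ f (initSeg (vReal E) (e k)) = true := by
    intro k
    have : e k ∈ Set.range e := ⟨k, rfl⟩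
    rwa [hr] at this
  have himg : (Finset.range (e m - 1)).filter (fun i => f (vState E i).1 = true) =
      (Finset.range m).image (fun k => e k - 1) := by
    ext i
    simp only [Finset.mem_filter, Finset.mem_range, Finset.mem_image]
    constructor
    · rintro ⟨hi, hfi⟩
      have : i + 1 ∈ Set.range e := by
        rw [hr]
        exact ⟨by omega, by rw [vInit]; exact hfi⟩
      obtain ⟨k, hk⟩ := this
      exact ⟨k, he.lt_iff_lt.1 (by omega), by omega⟩
    · rintro ⟨k, hk, rfl⟩
      have h1 := hmem k
      have h2 := he hk
      refine ⟨by omega, ?_⟩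
      rw [← vInit, Nat.sub_add_cancel h1.1]
      exact h1.2
  have hs := vSum E f hf (e m - 1)
  rw [himg, Finset.sum_image (by
    intro a _ b _ hab
    have h1 := (hmem a).1
    have h2 := (hmem b).1
    simp only at hab
    exact he.injective (by omega))] at hs
  have hs2 : (m : ℤ) - 2 * (Sf (vReal E) e m : ℤ) =
      ∑ A ∈ E.powerset.filter (fun A => f ∈ A), (bitVal ((vState E (e m - 1)).2 A) : ℤ) := by
    rw [← hs, Finset.sum_congr rfl (fun k _ => by rw [Nat.sub_add_cancel (hmem k).1]),
      Finset.sum_sub_distrib, ← Finset.mul_sum]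
    simp [Sf]
  rw [hs2]
  refine ⟨Finset.sum_nonneg (fun _ _ => by positivity), ?_⟩
  calc _ ≤ ∑ A ∈ E.powerset.filter (fun A => f ∈ A), (1 : ℤ) :=
        Finset.sum_le_sum (fun A _ => by unfold bitVal; split_ifs <;> simp)
    _ = ((E.powerset.filter (fun A => f ∈ A)).card : ℤ) := by simp
    _ ≤ (E.powerset.card : ℤ) := by exact_mod_cast Finset.card_filter_le _ _
    _ = 2 ^ E.card := by simp

/-- **Strengthened finite version of Ville's Theorem.** If the finite
collection `E` contains the always-care selection function, then there is a
real `q` such that every `f ∈ E` selecting an infinite subsequence of `q`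
satisfies `0 ≤ m/2 − S_{f,q}(m) ≤ 2^{card E}` for all `m ≥ 1`. -/
theorem ville_theorem_finite_strengthened (E : Finset (List Bool → Bool))
    (hE : (fun _ : List Bool => true) ∈ E) :
    ∃ q : ℕ → Bool,
      ∀ f ∈ E, ∀ e : ℕ → ℕ, StrictMono e →
        Set.range e = {n | 1 ≤ n ∧ f (initSeg q n) = true} →
        ∀ m : ℕ, 1 ≤ m →
          0 ≤ (m : ℝ) / 2 - (Sf q e m : ℝ) ∧
          (m : ℝ) / 2 - (Sf q e m : ℝ) ≤ 2 ^ E.card := by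
  refine ⟨vReal E, fun f hf e he hr m _ => ?_⟩
  obtain ⟨h1, h2⟩ := vBound E f e hf he hr m
  have h1' : (0 : ℝ) ≤ (m : ℝ) - 2 * (Sf (vReal E) e m : ℝ) := by exact_mod_cast h1
  have h2' : (m : ℝ) - 2 * (Sf (vReal E) e m : ℝ) ≤ 2 ^ E.card := by exact_mod_cast h2
  have h3 : (0 : ℝ) ≤ 2 ^ E.card := by positivity
  constructor <;> linarith
end

section
/- Parity-construction lemma: Let α be any type and B : {1,2,3,…} → α, and define the binary sequence q by q(n) = card{m < n : B(m) = B(n)} mod 2 (the preceding parity of B(n) in B). Then for every n ≥ 1, 2·(Σ_{i=1}^{n} q(i)) ≤ n; that is, in every initial segment of q the number of 1's does not exceed the number of 0's. -/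
/-- **Parity-construction lemma.** Let `B` map positive integers into an
arbitrary type `α`, and let `q n` be the preceding parity of `B n` in `B`,
i.e. `q n = card {m | 1 ≤ m ∧ m < n ∧ B m = B n} mod 2`. Then in every
initial segment of `q` the number of 1's does not exceed the number of 0's:
`2 · Σ_{i=1}^{n} q(i) ≤ n` for every `n ≥ 1`. -/
theorem parity_construction_lemma {α : Type*} (B : ℕ → α) (q : ℕ → ℕ)
    (hq : ∀ n : ℕ, q n = {m : ℕ | 1 ≤ m ∧ m < n ∧ B m = B n}.ncard % 2) :
    ∀ n : ℕ, 1 ≤ n → 2 * (∑ i ∈ Finset.Icc 1 n, q i) ≤ n := by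
  classical
  let c : ℕ → α → ℕ := fun n a => ((Finset.Icc 1 n).filter (fun m => B m = a)).card
  have hc : ∀ n a, c (n + 1) a = c n a + if B (n + 1) = a then 1 else 0 := by
    intro n a
    simp only [c]
    rw [← Finset.insert_Icc_right_eq_Icc_add_one (by omega), Finset.filter_insert]
    split_ifs with h
    · rw [Finset.card_insert_of_notMem (by simp)]
    · rfl
  have hqc : ∀ n, q (n + 1) = c n (B (n + 1)) % 2 := by
    intro n
    rw [hq]
    simp only [c]
    rw [← Set.ncard_coe_finset]
    congr 2
    ext m
    simp only [Set.mem_setOf_eq, Finset.coe_filter, Finset.mem_Icc]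
    constructor
    · rintro ⟨h1, h2, h3⟩
      exact ⟨⟨h1, by omega⟩, h3⟩
    · rintro ⟨⟨h1, h2⟩, h3⟩
      exact ⟨h1, by omega, h3⟩
  have key : ∀ n, ∃ O : Finset α, (∀ a, a ∈ O ↔ c n a % 2 = 1) ∧
      2 * (∑ i ∈ Finset.Icc 1 n, q i) + O.card = n := by
    intro n
    induction n with
    | zero => exact ⟨∅, by simp [c], by simp⟩
    | succ n ih =>
      obtain ⟨O, hO, hs⟩ := ih
      rw [Finset.sum_Icc_succ_top (by omega), hqc]
      by_cases h : B (n + 1) ∈ O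
      · refine ⟨O.erase (B (n + 1)), ?_, ?_⟩
        · intro a
          have h1 := (hO _).1 h
          rw [Finset.mem_erase, hO, hc]
          by_cases ha : B (n + 1) = a
          · subst ha; simp; omega
          · simp [ha, Ne.symm ha]
        · have h1 := (hO _).1 h
          have h2 := Finset.card_erase_add_one h
          omega
      · have h1 : c n (B (n + 1)) % 2 = 0 := by
          have h2 : ¬ c n (B (n + 1)) % 2 = 1 := fun h3 => h ((hO _).2 h3)
          omega
        refine ⟨insert (B (n + 1)) O, ?_, ?_⟩
        · intro a
          rw [Finset.mem_insert, hO, hc]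
          by_cases ha : B (n + 1) = a
          · subst ha; simp; omega
          · simp [ha, Ne.symm ha]
        · rw [Finset.card_insert_of_notMem h]
          omega
  intro n _
  obtain ⟨O, -, h⟩ := key n
  omega
end

section
/- Consecutive-zeros lemma for the parity construction: Let α be any type and B : {1,2,3,…} → α, and define the binary sequence q by q(n) = card{m < n : B(m) = B(n)} mod 2. If n ≤ n′ and q(i) = 0 for every i with n ≤ i ≤ n′, then the values B(n), B(n+1), …, B(n′) are pairwise distinct. Consequently, if B takes at most N distinct values, then q contains no block of more than N consecutive zeros. -/
/-- **Consecutive-zeros lemma for the parity construction.** Let `B` map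
positive integers into an arbitrary type `α`, and let `q n` be the preceding
parity of `B n` in `B`. If `q` vanishes on the whole block `[n, n']` then the
values `B n, …, B n'` are pairwise distinct; consequently, if `B` takes at
most `N` distinct values (on positions `≥ 1`), every block of consecutive
zeros of `q` has length at most `N`. -/
theorem parity_construction_consecutive_zeros {α : Type*} (B : ℕ → α) (q : ℕ → ℕ)
    (hq : ∀ n : ℕ, q n = {m : ℕ | 1 ≤ m ∧ m < n ∧ B m = B n}.ncard % 2) :
    (∀ n n' : ℕ, 1 ≤ n → n ≤ n' → (∀ i : ℕ, n ≤ i → i ≤ n' → q i = 0) →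
      ∀ i j : ℕ, n ≤ i → i < j → j ≤ n' → B i ≠ B j) ∧
    (∀ N : ℕ, ∀ s : Finset α, (∀ m : ℕ, 1 ≤ m → B m ∈ s) → s.card ≤ N →
      ∀ n n' : ℕ, 1 ≤ n → n ≤ n' → (∀ i : ℕ, n ≤ i → i ≤ n' → q i = 0) →
      n' - n + 1 ≤ N) := by
  have key : ∀ n n' : ℕ, 1 ≤ n → n ≤ n' → (∀ i : ℕ, n ≤ i → i ≤ n' → q i = 0) →
      ∀ i j : ℕ, n ≤ i → i < j → j ≤ n' → B i ≠ B j := by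
    intro n n' hn _ hz i j hi
    induction j using Nat.strong_induction_on with
    | _ j ih =>
      intro hij hj hB
      have hset : {m : ℕ | 1 ≤ m ∧ m < j ∧ B m = B j}
          = insert i {m : ℕ | 1 ≤ m ∧ m < i ∧ B m = B i} := by
        ext m
        simp only [Set.mem_setOf_eq, Set.mem_insert_iff]
        constructor
        · rintro ⟨h1, h2, h3⟩
          rcases lt_trichotomy m i with h | h | h
          · exact Or.inr ⟨h1, h, h3.trans hB.symm⟩
          · exact Or.inl h
          · exact absurd (hB.trans h3.symm) (ih m h2 h (by omega))
        · rintro (rfl | ⟨h1, h2, h3⟩)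
          · exact ⟨by omega, hij, hB⟩
          · exact ⟨h1, by omega, h3.trans hB⟩
      have hfin : {m : ℕ | 1 ≤ m ∧ m < i ∧ B m = B i}.Finite :=
        (Set.finite_lt_nat i).subset (fun m hm => hm.2.1)
      have hni : i ∉ {m : ℕ | 1 ≤ m ∧ m < i ∧ B m = B i} :=
        fun h => lt_irrefl i h.2.1
      have hc := Set.ncard_insert_of_notMem hni hfin
      have h1 := hz i hi (by omega)
      have h2 := hz j (by omega) hj
      rw [hq] at h1 h2
      rw [hset, hc] at h2
      omega
  refine ⟨key, ?_⟩
  intro N s hs hN n n' hn hnn hz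
  have hcard : (Finset.Icc n n').card ≤ s.card := by
    apply Finset.card_le_card_of_injOn B
    · intro m hm
      have hm' := Finset.mem_Icc.mp hm
      exact hs m (by omega)
    · intro a ha b hb hab
      have ha' := Finset.mem_Icc.mp ha
      have hb' := Finset.mem_Icc.mp hb
      rcases lt_trichotomy a b with h | h | h
      · exact absurd hab (key n n' hn hnn hz a b ha'.1 h hb'.2)
      · exact h
      · exact absurd hab.symm (key n n' hn hnn hz b a hb'.1 h ha'.2)
  rw [Nat.card_Icc] at hcard
  omega
end

section
/- Occurrence-count lemma: Suppose ℓ ≥ 1 satisfies ℓ ∈ A(n) for infinitely many n, and let n_1 < n_2 < ⋯ enumerate {n : ℓ ∈ A(n)}. For every k ≥ ℓ, if there exists m with I(n_m) = k + 1 and m₀ is the least such m, then there are at least 3^k indices m < m₀ with I(n_m) = k and ℓ ∈ A*(n_m); in particular, the value k occurs at least 3^k times in the sequence I(n_1), I(n_2), … prior to the first occurrence of k + 1. -/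
open Filter

/- Context: `A : {1,2,…} → Set ℕ` with `1 ∈ A n` for all `n ≥ 1`.  The index
function `I` and the sequence `A*` of finite sets are defined by simultaneous
recursion: `I n` is the least `i ≥ 1` such that some `j ∈ A n` with `j ≤ i`
satisfies `card {m < n : j ∈ A* m ∧ I m = i} ≤ 3 ^ i`, and
`A* n = {j ∈ A n | 1 ≤ j ∧ j ≤ I n}`.  We characterize `I` and `A*` by these
defining properties, stated as hypotheses `hI` and `hAstar`. -/
theorem occurrence_count_lemma (A : ℕ → Set ℕ) (hA : ∀ n : ℕ, 1 ≤ n → 1 ∈ A n)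
    (I : ℕ → ℕ) (Astar : ℕ → Set ℕ)
    (hI : ∀ n : ℕ, 1 ≤ n →
      IsLeast {i : ℕ | 1 ≤ i ∧ ∃ j ∈ A n, j ≤ i ∧
        {m : ℕ | 1 ≤ m ∧ m < n ∧ j ∈ Astar m ∧ I m = i}.ncard ≤ 3 ^ i} (I n))
    (hAstar : ∀ n : ℕ, 1 ≤ n → Astar n = {j ∈ A n | 1 ≤ j ∧ j ≤ I n})
    (ℓ : ℕ) (hℓ : 1 ≤ ℓ) (hinf : {n : ℕ | 1 ≤ n ∧ ℓ ∈ A n}.Infinite)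
    (e : ℕ → ℕ) (he : StrictMono e)
    (hrange : Set.range e = {n : ℕ | 1 ≤ n ∧ ℓ ∈ A n})
    : ∀ k : ℕ, ℓ ≤ k → ∀ m₀ : ℕ, IsLeast {m : ℕ | I (e m) = k + 1} m₀ →
        3 ^ k ≤ {m : ℕ | m < m₀ ∧ I (e m) = k ∧ ℓ ∈ Astar (e m)}.ncard ∧
        3 ^ k ≤ {m : ℕ | m < m₀ ∧ I (e m) = k}.ncard := by
  intro k hk m₀ hm₀
  have hmem : ∀ m, 1 ≤ e m ∧ ℓ ∈ A (e m) := fun m => by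
    have h : e m ∈ Set.range e := ⟨m, rfl⟩
    rw [hrange] at h
    exact h
  have hv : I (e m₀) = k + 1 := hm₀.1
  have hcard : 3 ^ k <
      {m : ℕ | 1 ≤ m ∧ m < e m₀ ∧ ℓ ∈ Astar m ∧ I m = k}.ncard := by
    by_contra hcon
    have h := (hI (e m₀) (hmem m₀).1).2
      (show k ∈ _ from ⟨hℓ.trans hk, ℓ, (hmem m₀).2, hk, not_lt.mp hcon⟩)
    omega
  have hfin : ∀ p : ℕ → Prop, {m : ℕ | m < m₀ ∧ p m}.Finite := fun p =>
    (Set.finite_lt_nat m₀).subset fun m hm => hm.1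
  have hsub : {m : ℕ | 1 ≤ m ∧ m < e m₀ ∧ ℓ ∈ Astar m ∧ I m = k} ⊆
      e '' {m : ℕ | m < m₀ ∧ I (e m) = k ∧ ℓ ∈ Astar (e m)} := by
    rintro n ⟨h1, h2, h3, h4⟩
    have hn : n ∈ Set.range e := by
      rw [hrange]
      have h3' := h3
      rw [hAstar n h1] at h3'
      exact ⟨h1, h3'.1⟩
    obtain ⟨m, rfl⟩ := hn
    exact ⟨m, ⟨he.lt_iff_lt.mp h2, h4, h3⟩, rfl⟩
  have hfirst : 3 ^ k ≤ {m : ℕ | m < m₀ ∧ I (e m) = k ∧ ℓ ∈ Astar (e m)}.ncard :=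
    hcard.le.trans ((Set.ncard_le_ncard hsub ((hfin _).image e)).trans
      (Set.ncard_image_le (hfin _)))
  exact ⟨hfirst, hfirst.trans
    (Set.ncard_le_ncard (fun m hm => ⟨hm.1, hm.2.1⟩) (hfin _))⟩
end

section
/- Nonexistence of infinitizing modifications of selection functions: there is no mapping D from selection functions to selection functions such that for every selection function f and every real q, (i) the set {n : D(f)(q[n]) = care} is infinite, and (ii) if the set {n : f(q[n]) = care} is infinite then {n : D(f)(q[n]) = care} = {n : f(q[n]) = care}. -/
/-- **Nonexistence of infinitizing modifications of selection functions.**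
There is no map `D` from selection functions (maps from finite binary
sequences to `{care, don't care}`, with `true` = care) to selection functions
such that for every selection function `f` and every real `q`:
(i) `{n : D f (q[n]) = care}` is infinite, and (ii) whenever
`{n : f (q[n]) = care}` is infinite, `{n : D f (q[n]) = care} = {n : f (q[n]) = care}`. -/
theorem no_infinitizing_modification :
    ¬ ∃ D : (List Bool → Bool) → (List Bool → Bool),
        ∀ f : List Bool → Bool, ∀ q : ℕ → Bool,
          {n : ℕ | 1 ≤ n ∧ D f (initSeg q n) = true}.Infinite ∧
          ({n : ℕ | 1 ≤ n ∧ f (initSeg q n) = true}.Infinite →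
            {n : ℕ | 1 ≤ n ∧ D f (initSeg q n) = true} =
              {n : ℕ | 1 ≤ n ∧ f (initSeg q n) = true}) := by
  rintro ⟨D, hD⟩
  obtain ⟨n, hn1, hn⟩ := (hD (fun s => s.any id) (fun _ => false)).1.nonempty
  have hseg : initSeg (fun i => decide (n ≤ i)) n = initSeg (fun _ => false) n := by
    unfold initSeg
    apply List.map_congr_left
    intro i hi
    rw [List.mem_range] at hi
    simp only [decide_eq_false_iff_not]
    omega
  have hinf : {k : ℕ | 1 ≤ k ∧
      (fun s : List Bool => s.any id) (initSeg (fun i => decide (n ≤ i)) k) = true}.Infinite := by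
    apply (Set.Ici_infinite (n + 1)).mono
    intro k hk
    have hk' : n + 1 ≤ k := hk
    refine ⟨by omega, ?_⟩
    simp only [initSeg, List.any_eq_true, List.mem_map, List.mem_range]
    refine ⟨true, ⟨n - 1, by omega, ?_⟩, rfl⟩
    simp only [decide_eq_true_eq]
    omega
  have heq := (hD (fun s => s.any id) (fun i => decide (n ≤ i))).2 hinf
  have hmem : n ∈ {k : ℕ | 1 ≤ k ∧
      D (fun s => s.any id) (initSeg (fun i => decide (n ≤ i)) k) = true} :=
    ⟨hn1, by rw [hseg]; exact hn⟩
  rw [heq] at hmem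
  have h2 := hmem.2
  rw [hseg] at h2
  simp [initSeg] at h2
end
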